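/- arXiv:1903.00208 — 4 statements merged into one kernel-verified Lean document; each statement's English description precedes it below -/
import Mathlib

section
/- If a graph G contains a pyramid, then G has an odd hole. -/
/-!
Common definitions: holes, odd holes, C-major vertices, induced paths,
pyramids, jewels, candidates, x-gaps, gaps and normal sets.
A hole of length `n` is encoded as an injective map `f : ZMod n → V`
such that adjacency in `G` between vertices of the hole holds exactly
for consecutive indices (i.e. the hole is an induced cycle).
-/

variable {V : Type*}

/-- A hole: an induced cycle of length `n ≥ 4`. -/
def IsHole (G : SimpleGraph V) (n : ℕ) (f : ZMod n → V) : Prop :=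
  4 ≤ n ∧ Function.Injective f ∧
    ∀ i j : ZMod n, G.Adj (f i) (f j) ↔ (j = i + 1 ∨ i = j + 1)

/-- An odd hole. -/
def IsOddHole (G : SimpleGraph V) (n : ℕ) (f : ZMod n → V) : Prop :=
  IsHole G n f ∧ Odd n

/-- A shortest odd hole: an odd hole of minimum length among all odd holes. -/
def IsShortestOddHole (G : SimpleGraph V) (n : ℕ) (f : ZMod n → V) : Prop :=
  IsOddHole G n f ∧ ∀ (m : ℕ) (g : ZMod m → V), IsOddHole G m g → n ≤ m

/-- `G` has an odd hole. -/
def HasOddHole (G : SimpleGraph V) : Prop :=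
  ∃ (n : ℕ) (f : ZMod n → V), IsOddHole G n f

/-- A vertex `v` is `C`-major (for the hole given by `f`): `v` is not on the hole and
no three consecutive vertices of the hole contain all neighbours of `v` on the hole. -/
def IsCMajor (G : SimpleGraph V) {n : ℕ} (f : ZMod n → V) (v : V) : Prop :=
  v ∉ Set.range f ∧
    ∀ i : ZMod n, ∃ j : ZMod n, G.Adj v (f j) ∧ j ≠ i - 1 ∧ j ≠ i ∧ j ≠ i + 1

/-- An induced path of length `k`, encoded by its sequence of vertices:
adjacency holds exactly between consecutive vertices. -/
def IsInducedPathMap (G : SimpleGraph V) (k : ℕ) (p : Fin (k + 1) → V) : Prop :=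
  Function.Injective p ∧
    ∀ i j : Fin (k + 1), G.Adj (p i) (p j) ↔ (i.val + 1 = j.val ∨ j.val + 1 = i.val)

/-- A (not necessarily induced) path of length `k`, encoded by its sequence of vertices. -/
def IsPathMap (G : SimpleGraph V) (k : ℕ) (p : Fin (k + 1) → V) : Prop :=
  Function.Injective p ∧ ∀ i : Fin k, G.Adj (p i.castSucc) (p i.succ)

/-- A pyramid with apex `v0`, base `{v1, v2, v3}`, and paths `p1, p2, p3`
(of lengths `k1, k2, k3`) from `v0` to `v1, v2, v3` respectively. -/
def IsPyramid (G : SimpleGraph V) (v0 v1 v2 v3 : V) (k1 k2 k3 : ℕ)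
    (p1 : Fin (k1 + 1) → V) (p2 : Fin (k2 + 1) → V) (p3 : Fin (k3 + 1) → V) : Prop :=
  IsInducedPathMap G k1 p1 ∧ IsInducedPathMap G k2 p2 ∧ IsInducedPathMap G k3 p3 ∧
  p1 0 = v0 ∧ p2 0 = v0 ∧ p3 0 = v0 ∧
  p1 (Fin.last k1) = v1 ∧ p2 (Fin.last k2) = v2 ∧ p3 (Fin.last k3) = v3 ∧
  v1 ≠ v0 ∧ v2 ≠ v0 ∧ v3 ≠ v0 ∧
  G.Adj v1 v2 ∧ G.Adj v1 v3 ∧ G.Adj v2 v3 ∧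
  ((2 ≤ k1 ∧ 2 ≤ k2) ∨ (2 ≤ k1 ∧ 2 ≤ k3) ∨ (2 ≤ k2 ∧ 2 ≤ k3)) ∧
  (Set.range p1 ∩ Set.range p2 ⊆ {v0}) ∧
  (Set.range p1 ∩ Set.range p3 ⊆ {v0}) ∧
  (Set.range p2 ∩ Set.range p3 ⊆ {v0}) ∧
  (∀ u w : V, u ∈ Set.range p1 → w ∈ Set.range p2 → u ≠ v0 → w ≠ v0 →
    G.Adj u w → u = v1 ∧ w = v2) ∧
  (∀ u w : V, u ∈ Set.range p1 → w ∈ Set.range p3 → u ≠ v0 → w ≠ v0 →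
    G.Adj u w → u = v1 ∧ w = v3) ∧
  (∀ u w : V, u ∈ Set.range p2 → w ∈ Set.range p3 → u ≠ v0 → w ≠ v0 →
    G.Adj u w → u = v2 ∧ w = v3)

/-- `G` contains a pyramid. -/
def ContainsPyramid (G : SimpleGraph V) : Prop :=
  ∃ (v0 v1 v2 v3 : V) (k1 k2 k3 : ℕ) (p1 : Fin (k1 + 1) → V)
    (p2 : Fin (k2 + 1) → V) (p3 : Fin (k3 + 1) → V),
    IsPyramid G v0 v1 v2 v3 k1 k2 k3 p1 p2 p3

/-- A jewel on vertices `v1, …, v5` together with the path `p` (of length `k`)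
from `v1` to `v4`. -/
def IsJewel (G : SimpleGraph V) (v1 v2 v3 v4 v5 : V) (k : ℕ)
    (p : Fin (k + 1) → V) : Prop :=
  List.Pairwise Ne [v1, v2, v3, v4, v5] ∧
  G.Adj v1 v2 ∧ G.Adj v2 v3 ∧ G.Adj v3 v4 ∧ G.Adj v4 v5 ∧ G.Adj v5 v1 ∧
  ¬ G.Adj v1 v3 ∧ ¬ G.Adj v2 v4 ∧ ¬ G.Adj v1 v4 ∧
  IsInducedPathMap G k p ∧ p 0 = v1 ∧ p (Fin.last k) = v4 ∧
  ∀ i : Fin (k + 1), i ≠ 0 → i ≠ Fin.last k →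
    ¬ G.Adj v2 (p i) ∧ ¬ G.Adj v3 (p i) ∧ ¬ G.Adj v5 (p i)

/-- `G` contains a jewel. -/
def ContainsJewel (G : SimpleGraph V) : Prop :=
  ∃ (v1 v2 v3 v4 v5 : V) (k : ℕ) (p : Fin (k + 1) → V),
    IsJewel G v1 v2 v3 v4 v5 k p

/-- A candidate: a graph with no jewel, no pyramid, and no heavy-cleanable shortest
odd hole (a shortest odd hole is heavy-cleanable if some edge of it has the property
that every major vertex is adjacent to one of its ends). -/
def Candidate (G : SimpleGraph V) : Prop :=
  ¬ ContainsJewel G ∧ ¬ ContainsPyramid G ∧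
  ¬ ∃ (n : ℕ) (f : ZMod n → V) (i : ZMod n), IsShortestOddHole G n f ∧
      ∀ v : V, IsCMajor G f v → (G.Adj v (f i) ∨ G.Adj v (f (i + 1)))

/-- An `x`-gap of a hole `f : ZMod n → V`: an induced path of the hole, of length
`ℓ ≥ 2`, starting at index `a` and ending at index `a + ℓ`, whose ends are adjacent
to `x` and whose internal vertices are nonadjacent to `x`. (The condition `ℓ + 2 ≤ n`
says that the arc is an induced path of the hole.) -/
def IsXGap (G : SimpleGraph V) {n : ℕ} (f : ZMod n → V) (x : V) (a : ZMod n)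
    (ℓ : ℕ) : Prop :=
  2 ≤ ℓ ∧ ℓ + 2 ≤ n ∧ G.Adj x (f a) ∧ G.Adj x (f (a + (ℓ : ZMod n))) ∧
    ∀ t : ℕ, 0 < t → t < ℓ → ¬ G.Adj x (f (a + (t : ZMod n)))

/-- `ℓ` is the length of an `A`-gap of the cycle on `ZMod n` (with `A ⊆ ZMod n`):
either `A = ∅` and the gap is the whole cycle, or the gap runs from some `i ∈ A`
to `i + ℓ ∈ A` with no internal vertex in `A`. -/
def IsGapLength (n : ℕ) (A : Set (ZMod n)) (ℓ : ℕ) : Prop :=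
  (A = ∅ ∧ ℓ = n) ∨
  (2 ≤ ℓ ∧ ℓ ≤ n ∧ ∃ i ∈ A, (i + (ℓ : ZMod n)) ∈ A ∧
    ∀ t : ℕ, 0 < t → t < ℓ → (i + (t : ZMod n)) ∉ A)

/-- `A` is normal in the cycle on `ZMod n`: every `A`-gap has even length. -/
def NormalInCycle (n : ℕ) (A : Set (ZMod n)) : Prop :=
  ∀ ℓ : ℕ, IsGapLength n A ℓ → Even ℓ

/-- A sequence of `n ≥ 4` vertices whose only adjacencies are the cyclically consecutive ones
gives a hole. -/
theorem isHole_of_nat {G : SimpleGraph V} {n : ℕ} (hn : 4 ≤ n) (g : ℕ → V)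
    (hne : ∀ i j, i < j → j < n → g i ≠ g j)
    (hadj : ∀ i j, i < j → j < n → (G.Adj (g i) (g j) ↔ (j = i + 1 ∨ (i = 0 ∧ j + 1 = n)))) :
    IsHole G n (fun i => g i.val) := by
  have : NeZero n := ⟨by omega⟩
  have : Fact (1 < n) := ⟨by omega⟩
  have hsucc : ∀ a b : ZMod n,
      b = a + 1 ↔ (b.val = a.val + 1 ∨ (b.val = 0 ∧ a.val + 1 = n)) := by
    intro a b
    have ha := ZMod.val_lt a
    have hb := ZMod.val_lt b
    rw [← (ZMod.val_injective n).eq_iff, ZMod.val_add, ZMod.val_one]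
    rcases Nat.lt_or_ge (a.val + 1) n with h | h
    · rw [Nat.mod_eq_of_lt h]
      omega
    · have h' : a.val + 1 = n := by omega
      rw [h', Nat.mod_self]
      omega
  refine ⟨hn, fun a b hab => ?_, fun a b => ?_⟩
  · apply ZMod.val_injective n
    rcases lt_trichotomy a.val b.val with h | h | h
    · exact absurd hab (hne _ _ h (ZMod.val_lt b))
    · exact h
    · exact absurd hab.symm (hne _ _ h (ZMod.val_lt a))
  · have ha := ZMod.val_lt a
    have hb := ZMod.val_lt b
    rw [hsucc, hsucc]
    rcases lt_trichotomy a.val b.val with h | h | h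
    · rw [hadj _ _ h hb]
      omega
    · obtain rfl := ZMod.val_injective n h
      refine iff_of_false G.irrefl ?_
      omega
    · rw [G.adj_comm, hadj _ _ h ha]
      omega

/-- Two induced paths of equal length parity from a common vertex, otherwise disjoint and joined
only by an edge between their other ends, form an odd hole. -/
theorem hasOddHole_of_two_paths {G : SimpleGraph V} {v a b : V} {k l : ℕ}
    {p : Fin (k + 1) → V} {q : Fin (l + 1) → V}
    (hp : IsInducedPathMap G k p) (hq : IsInducedPathMap G l q)
    (hp0 : p 0 = v) (hq0 : q 0 = v) (hpl : p (Fin.last k) = a) (hql : q (Fin.last l) = b)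
    (hab : G.Adj a b) (hdisj : Set.range p ∩ Set.range q ⊆ {v})
    (hedge : ∀ u w : V, u ∈ Set.range p → w ∈ Set.range q → u ≠ v → w ≠ v →
      G.Adj u w → u = a ∧ w = b)
    (hkl : 3 ≤ k + l) (heven : Even (k + l)) : HasOddHole G := by
  obtain ⟨hpinj, hpadj⟩ := hp
  obtain ⟨hqinj, hqadj⟩ := hq
  subst hp0 hpl hql
  have hpne : ∀ i : Fin (k + 1), i.val ≠ 0 → p i ≠ p 0 := fun i hi h =>
    hi (congrArg Fin.val (hpinj h))
  have hqne : ∀ i : Fin (l + 1), i.val ≠ 0 → q i ≠ p 0 := fun i hi h =>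
    hi (congrArg Fin.val (hqinj (h.trans hq0.symm)))
  have hpq : ∀ (i : Fin (k + 1)) (j : Fin (l + 1)), j.val ≠ 0 → p i ≠ q j := fun i j hj h =>
    hqne j hj (hdisj ⟨⟨i, h⟩, ⟨j, rfl⟩⟩)
  have hpqadj : ∀ (i : Fin (k + 1)) (j : Fin (l + 1)), j.val ≠ 0 →
      (G.Adj (p i) (q j) ↔ ((i.val = k ∧ j.val = l) ∨ (i.val = 0 ∧ j.val = 1))) := by
    intro i j hj
    by_cases hi : i.val = 0
    · obtain rfl : i = 0 := Fin.ext hi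
      rw [← hq0, hqadj]
      simp only [Fin.val_zero, true_and]
      constructor
      · intro h
        omega
      · rintro (⟨hk, hl⟩ | h)
        · subst hk
          have hadj := hab
          rw [show Fin.last 0 = 0 from rfl, ← hq0, hqadj] at hadj
          simp only [Fin.val_zero, Fin.val_last] at hadj
          omega
        · omega
    · constructor
      · intro h
        obtain ⟨h1, h2⟩ := hedge _ _ ⟨i, rfl⟩ ⟨j, rfl⟩ (hpne i hi) (hqne j hj) h
        exact Or.inl ⟨congrArg Fin.val (hpinj h1), congrArg Fin.val (hqinj h2)⟩
      · rintro (⟨h1, h2⟩ | h)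
        · rw [show i = Fin.last k from Fin.ext h1, show j = Fin.last l from Fin.ext h2]
          exact hab
        · exact absurd h.1 hi
  refine ⟨k + l + 1, _, isHole_of_nat (by omega)
    (fun i => if i ≤ k then p (Fin.ofNat (k + 1) i) else q (Fin.ofNat (l + 1) (k + l + 1 - i)))
    ?_ ?_, heven.add_one⟩
  · intro i j hij hj
    rcases Nat.lt_or_ge k i with hi | hi
    · have hj' : k < j := by omega
      simp only [hi.not_ge, hj'.not_ge, if_false]
      intro h
      have := congrArg Fin.val (hqinj h)
      simp only [Fin.val_ofNat] at this
      rw [Nat.mod_eq_of_lt (by omega), Nat.mod_eq_of_lt (by omega)] at this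
      omega
    rcases Nat.lt_or_ge k j with hj' | hj'
    · simp only [hi, hj'.not_ge, if_true, if_false]
      apply hpq
      simp only [Fin.val_ofNat]
      rw [Nat.mod_eq_of_lt (by omega)]
      omega
    · simp only [hi, hj', if_true]
      intro h
      have := congrArg Fin.val (hpinj h)
      simp only [Fin.val_ofNat] at this
      rw [Nat.mod_eq_of_lt (by omega), Nat.mod_eq_of_lt (by omega)] at this
      omega
  · intro i j hij hj
    rcases Nat.lt_or_ge k i with hi | hi
    · have hj' : k < j := by omega
      simp only [hi.not_ge, hj'.not_ge, if_false]
      rw [hqadj]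
      simp only [Fin.val_ofNat]
      rw [Nat.mod_eq_of_lt (by omega), Nat.mod_eq_of_lt (by omega)]
      omega
    rcases Nat.lt_or_ge k j with hj' | hj'
    · have hmod : (k + l + 1 - j) % (l + 1) = k + l + 1 - j := Nat.mod_eq_of_lt (by omega)
      simp only [hi, hj'.not_ge, if_true, if_false]
      rw [hpqadj _ _ (by simp only [Fin.val_ofNat]; omega)]
      simp only [Fin.val_ofNat]
      rw [hmod, Nat.mod_eq_of_lt (by omega)]
      omega
    · have hl : l ≠ 0 := by
        rintro rfl
        have hadj := hab
        rw [show Fin.last 0 = 0 from rfl, hq0, hpadj] at hadj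
        simp only [Fin.val_zero, Fin.val_last] at hadj
        omega
      simp only [hi, hj', if_true]
      rw [hpadj]
      simp only [Fin.val_ofNat]
      rw [Nat.mod_eq_of_lt (by omega), Nat.mod_eq_of_lt (by omega)]
      omega

/-- If a graph `G` contains a pyramid, then `G` has an odd hole. -/
theorem pyramid_implies_odd_hole {V : Type*} [Fintype V] (G : SimpleGraph V)
    (h : ContainsPyramid G) : HasOddHole G := by
  obtain ⟨v0, v1, v2, v3, k1, k2, k3, p1, p2, p3, hp1, hp2, hp3, h10, h20, h30, h1l, h2l, h3l,
    hv1, hv2, hv3, h12, h13, h23, hk, hd12, hd13, hd23, he12, he13, he23⟩ := h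
  have length_pos : ∀ {k : ℕ} {p : Fin (k + 1) → V} {v : V},
      p 0 = v0 → p (Fin.last k) = v → v ≠ v0 → 1 ≤ k := by
    intro k p v h0 hl hv
    rcases Nat.eq_zero_or_pos k with rfl | h
    · exact absurd (hl.symm.trans h0) hv
    · exact h
  have hk1 := length_pos h10 h1l hv1
  have hk2 := length_pos h20 h2l hv2
  have hk3 := length_pos h30 h3l hv3
  have parity : Even (k1 + k2) ∨ Even (k1 + k3) ∨ Even (k2 + k3) := by
    simp only [Nat.even_iff]
    omega
  rcases parity with h | h | h
  · exact hasOddHole_of_two_paths hp1 hp2 h10 h20 h1l h2l h12 hd12 he12 (by omega) h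
  · exact hasOddHole_of_two_paths hp1 hp3 h10 h30 h1l h3l h13 hd13 he13 (by omega) h
  · exact hasOddHole_of_two_paths hp2 hp3 h20 h30 h2l h3l h23 hd23 he23 (by omega) h
end

section
/- If a graph G contains a jewel, then G has an odd hole. -/
/-!
Common definitions: holes, odd holes, C-major vertices, induced paths,
pyramids, jewels, candidates, x-gaps, gaps and normal sets.
A hole of length `n` is encoded as an injective map `f : ZMod n → V`
such that adjacency in `G` between vertices of the hole holds exactly
for consecutive indices (i.e. the hole is an induced cycle).
-/

variable {V : Type*}

/-- An induced path extended by a vertex whose only neighbour on it is its last vertex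
is an induced path. -/
theorem IsInducedPathMap.snoc {G : SimpleGraph V} {k : ℕ} {p : Fin (k + 1) → V}
    (hp : IsInducedPathMap G k p) {x : V} (hx : ∀ i, p i ≠ x)
    (hadj : ∀ i, G.Adj x (p i) ↔ i = Fin.last k) :
    IsInducedPathMap G (k + 1) (Fin.snoc p x : Fin (k + 1 + 1) → V) := by
  refine ⟨Fin.snoc_injective_iff.2 ⟨hp.1, fun ⟨i, hi⟩ => hx i hi⟩, fun i j => ?_⟩
  induction i using Fin.lastCases with
  | last =>
    induction j using Fin.lastCases with
    | last => simp
    | cast j => simp [hadj, Fin.ext_iff]; omega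
  | cast i =>
    induction j using Fin.lastCases with
    | last => simp [G.adj_comm _ x, hadj, Fin.ext_iff]; omega
    | cast j => simpa using hp.2 i j

/-- An induced path of length at least two together with a vertex whose neighbours on it
are exactly its two ends forms a hole. -/
theorem IsInducedPathMap.isHole_snoc {G : SimpleGraph V} {k : ℕ} {p : Fin (k + 1) → V}
    (hp : IsInducedPathMap G k p) (hk : 2 ≤ k) {x : V} (hx : ∀ i, p i ≠ x)
    (hadj : ∀ i, G.Adj x (p i) ↔ i = 0 ∨ i = Fin.last k) :
    IsHole G (k + 2) (Fin.snoc p x : Fin (k + 1 + 1) → V) := by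
  refine ⟨by omega, Fin.snoc_injective_iff.2 ⟨hp.1, fun ⟨i, hi⟩ => hx i hi⟩, ?_⟩
  change ∀ i j : Fin (k + 1 + 1), _ ↔ (j = i + 1 ∨ i = j + 1)
  intro i j
  rw [Fin.ext_iff, Fin.ext_iff, Fin.val_add_one, Fin.val_add_one]
  induction i using Fin.lastCases with
  | last =>
    induction j using Fin.lastCases with
    | last => simp
    | cast j =>
      simp only [Fin.snoc_last, Fin.snoc_castSucc, hadj, Fin.ext_iff, Fin.val_last,
        Fin.val_castSucc, Fin.val_zero]
      grind
  | cast i =>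
    induction j using Fin.lastCases with
    | last =>
      simp only [Fin.snoc_last, Fin.snoc_castSucc, G.adj_comm _ x, hadj, Fin.ext_iff,
        Fin.val_last, Fin.val_castSucc, Fin.val_zero]
      grind
    | cast j =>
      simp only [Fin.snoc_castSucc, hp.2 i j, Fin.ext_iff, Fin.val_last, Fin.val_castSucc]
      grind

/-- If a graph `G` contains a jewel, then `G` has an odd hole. -/
theorem jewel_implies_odd_hole {V : Type*} [Fintype V] (G : SimpleGraph V)
    (h : ContainsJewel G) : HasOddHole G := by
  obtain ⟨v1, v2, v3, v4, v5, k, p, hne, h12, h23, h34, h45, h51, h13, h24, h14,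
    hp, hp0, hpk, hint⟩ := h
  simp only [List.pairwise_cons, List.mem_cons, List.not_mem_nil, or_false, forall_eq_or_imp,
    forall_eq] at hne
  have hk0 : k ≠ 0 := by
    rintro rfl
    exact hne.1.2.2.1 (hp0.symm.trans hpk)
  have hk1 : k ≠ 1 := by
    rintro rfl
    exact h14 (hp0 ▸ hpk ▸ (hp.2 _ _).2 (by simp))
  have hk : 2 ≤ k := by omega
  have end_cases (i : Fin (k + 1)) :
      i = 0 ∨ i = Fin.last k ∨ (i ≠ 0 ∧ i ≠ Fin.last k) := by tauto
  have hpos : (0 : Fin (k + 1)) ≠ Fin.last k := by simp [Fin.ext_iff]; omega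
  rcases Nat.even_or_odd k with hev | hodd
  · have hv2 (i) : p i ≠ v2 := by
      intro hi
      have h1 := (hp.2 0 i).1 (by rw [hp0, hi]; exact h12)
      have h2 : G.Adj v2 (p ⟨2, by omega⟩) := by
        rw [← hi, hp.2]
        simp at h1 ⊢
        omega
      rcases end_cases ⟨2, by omega⟩ with h | h | h
      · simp [Fin.ext_iff] at h
      · exact h24 (hpk ▸ h ▸ h2)
      · exact (hint _ h.1 h.2).1 h2
    have hv3 (i) : p i ≠ v3 := by
      intro hi
      have h1 := (hp.2 i (Fin.last k)).1 (by rw [hpk, hi]; exact h34)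
      have h2 : G.Adj v3 (p ⟨k - 2, by omega⟩) := by
        rw [← hi, hp.2]
        simp at h1 ⊢
        omega
      rcases end_cases ⟨k - 2, by omega⟩ with h | h | h
      · exact h13 (hp0 ▸ h ▸ h2).symm
      · simp [Fin.ext_iff] at h
        omega
      · exact (hint _ h.1 h.2).2.1 h2
    have hq : IsInducedPathMap G (k + 1) (Fin.snoc p v3 : Fin (k + 1 + 1) → V) := by
      refine hp.snoc hv3 fun i => ?_
      rcases end_cases i with rfl | rfl | h
      · simpa [hp0, hpos, G.adj_comm v3] using h13
      · simpa [hpk] using h34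
      · simpa [h.2] using (hint i h.1 h.2).2.1
    refine ⟨_, _, hq.isHole_snoc (x := v2) (by omega) ?_ ?_, by grind⟩
    · intro i
      induction i using Fin.lastCases with
      | last => simpa using h23.ne'
      | cast i => simpa using hv2 i
    · intro i
      induction i using Fin.lastCases with
      | last => simpa using h23
      | cast i =>
        rcases end_cases i with rfl | rfl | h
        · simpa [hp0] using h12.symm
        · simpa [hpk, Fin.ext_iff, hk0] using h24
        · simpa [h.1, Fin.castSucc_ne_last] using (hint i h.1 h.2).1
  · refine ⟨_, _, hp.isHole_snoc (x := v5) hk ?_ ?_, by grind⟩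
    · intro i hi
      have h1 := (hp.2 i 0).1 (by rw [hp0, hi]; exact h51)
      have h2 := (hp.2 (Fin.last k) i).1 (by rw [hpk, hi]; exact h45)
      simp at h1 h2
      grind
    · intro i
      rcases end_cases i with rfl | rfl | h
      · simpa [hp0] using h51
      · simpa [hpk] using h45.symm
      · simpa [h.1, h.2] using (hint i h.1 h.2).2.2
end

section
/- If a graph G contains a jewel in which v5 is adjacent to exactly one of v2, v3, then G contains a pyramid. -/
/-!
Common definitions: holes, odd holes, C-major vertices, induced paths,
pyramids, jewels, candidates, x-gaps, gaps and normal sets.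
A hole of length `n` is encoded as an injective map `f : ZMod n → V`
such that adjacency in `G` between vertices of the hole holds exactly
for consecutive indices (i.e. the hole is an induced cycle).
-/

variable {V : Type*}

/-- Reversing an induced path gives an induced path. -/
theorem IsInducedPathMap.rev {V : Type*} {G : SimpleGraph V} {k : ℕ} {p : Fin (k + 1) → V}
    (h : IsInducedPathMap G k p) : IsInducedPathMap G k (p ∘ Fin.rev) := by
  refine ⟨h.1.comp Fin.rev_injective, fun i j => ?_⟩
  have hi := i.isLt
  have hj := j.isLt
  simp only [Function.comp_apply, h.2, Fin.val_rev]
  omega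

/-- A jewel read backwards, with its path reversed, is a jewel. -/
theorem IsJewel.rev {V : Type*} {G : SimpleGraph V} {v1 v2 v3 v4 v5 : V} {k : ℕ}
    {p : Fin (k + 1) → V} (h : IsJewel G v1 v2 v3 v4 v5 k p) :
    IsJewel G v4 v3 v2 v1 v5 k (p ∘ Fin.rev) := by
  obtain ⟨hne, h12, h23, h34, h45, h51, n13, n24, n14, hp, hp0, hpk, hint⟩ := h
  refine ⟨?_, h34.symm, h23.symm, h12.symm, h51.symm, h45.symm, fun h => n24 h.symm,
    fun h => n13 h.symm, fun h => n14 h.symm, hp.rev, by simpa using hpk, by simpa using hp0,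
    fun i hi0 hik => ?_⟩
  · simp only [List.pairwise_cons, List.mem_cons] at hne ⊢
    grind
  · obtain ⟨h2, h3, h5⟩ := hint i.rev
      (fun h => hik (by rw [← Fin.rev_rev i, h, Fin.rev_zero]))
      (fun h => hi0 (by rw [← Fin.rev_rev i, h, Fin.rev_last]))
    exact ⟨h3, h2, h5⟩

/-- A jewel in which `v5` is adjacent to `v3` but not to `v2` contains a pyramid with apex `v1`
and base `{v5, v3, v4}`. -/
theorem IsJewel.containsPyramid_of_adj_of_not_adj {V : Type*} {G : SimpleGraph V}
    {v1 v2 v3 v4 v5 : V} {k : ℕ} {p : Fin (k + 1) → V} (h : IsJewel G v1 v2 v3 v4 v5 k p)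
    (h53 : G.Adj v5 v3) (n52 : ¬ G.Adj v5 v2) : ContainsPyramid G := by
  obtain ⟨hne, h12, h23, h34, h45, h51, n13, n24, n14, hp, hp0, hpk, hint⟩ := h
  simp only [List.pairwise_cons, List.mem_cons] at hne
  have hk : 2 ≤ k := by
    by_contra hk
    obtain rfl | rfl : k = 0 ∨ k = 1 := by omega
    · exact hne.1 v4 (by simp) (hp0.symm.trans hpk)
    · exact n14 (by rw [← hp0, ← hpk, hp.2]; simp)
  have hmem : ∀ w ∈ Set.range p,
      w = v1 ∨ w = v4 ∨ (¬ G.Adj v2 w ∧ ¬ G.Adj v3 w ∧ ¬ G.Adj v5 w) := by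
    rintro _ ⟨i, rfl⟩
    by_cases hi0 : i = 0
    · exact Or.inl (hi0 ▸ hp0)
    by_cases hik : i = Fin.last k
    · exact Or.inr (Or.inl (hik ▸ hpk))
    · exact Or.inr (Or.inr (hint i hi0 hik))
  have hsymm := G.adj_comm
  refine ⟨v1, v5, v3, v4, 1, 2, k, ![v1, v5], ![v1, v2, v3], p, ⟨?_, ?_⟩, ⟨?_, ?_⟩, hp,
    rfl, rfl, hp0, rfl, rfl, hpk, by grind, by grind, by grind, h53, h45.symm, h34,
    Or.inr (Or.inr ⟨le_rfl, hk⟩), ?_, ?_, ?_, ?_, ?_, ?_⟩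
  · intro i j; fin_cases i <;> fin_cases j <;> simp <;> grind
  · intro i j; fin_cases i <;> fin_cases j <;> simp <;> grind
  · intro i j; fin_cases i <;> fin_cases j <;> simp <;> grind
  · intro i j; fin_cases i <;> fin_cases j <;> simp <;> grind
  · simp [Set.subset_def]; grind
  · rintro w ⟨hw, hw'⟩
    have := hmem w hw'
    simp at hw ⊢
    grind
  · rintro w ⟨hw, hw'⟩
    have := hmem w hw'
    simp at hw ⊢
    grind
  · intro u w hu hw
    simp at hu hw
    grind
  · intro u w hu hw
    have := hmem w hw
    simp at hu
    grind
  · intro u w hu hw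
    have := hmem w hw
    simp at hu
    grind

/-- If `G` contains a jewel in which `v5` is adjacent to exactly one of
`v2, v3`, then `G` contains a pyramid. -/
theorem jewel_one_adjacency_implies_pyramid {V : Type*} [Fintype V] (G : SimpleGraph V)
    (v1 v2 v3 v4 v5 : V) (k : ℕ) (p : Fin (k + 1) → V)
    (hJ : IsJewel G v1 v2 v3 v4 v5 k p)
    (hone : (G.Adj v5 v2 ∧ ¬ G.Adj v5 v3) ∨ (¬ G.Adj v5 v2 ∧ G.Adj v5 v3)) :
    ContainsPyramid G := by
  obtain ⟨h52, n53⟩ | ⟨n52, h53⟩ := hone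
  · exact hJ.rev.containsPyramid_of_adj_of_not_adj h52 n53
  · exact hJ.containsPyramid_of_adj_of_not_adj h53 n52
end

section
/- Let G be a graph containing no jewel or pyramid, let C be a shortest odd hole in G, and let X be a stable set of C-major vertices. Then the set of X-complete vertices of C is normal in C. -/
/-!
Common definitions: holes, odd holes, C-major vertices, induced paths,
pyramids, jewels, candidates, x-gaps, gaps and normal sets.
A hole of length `n` is encoded as an injective map `f : ZMod n → V`
such that adjacency in `G` between vertices of the hole holds exactly
for consecutive indices (i.e. the hole is an induced cycle).
-/

variable {V : Type*}

/-- The arc `[a, b]` meets `A` exactly in `a` and meets `B` exactly in `b`. -/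
def Link (A B : ℤ → Prop) (a b : ℤ) : Prop :=
  a ≤ b ∧ A a ∧ B b ∧ ∀ k, a ≤ k → k ≤ b → (A k → k = a) ∧ (B k → k = b)

/-- The properties of the set of neighbours of a major vertex on a shortest odd hole,
read off along the universal cover `ℤ` of the hole. -/
structure MajorTrace (n : ℤ) (A : ℤ → Prop) : Prop where
  periodic : ∀ k, A (k + n) ↔ A k
  gap : ∀ i j, i < j → A i → A j → (∀ k, i < k → k < j → ¬ A k) → (j - i) % 2 = 1 → j = i + 1
  major : ∀ i, ∃ k, i + 1 < k ∧ k < i + n - 1 ∧ A k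
  not_triple : ∀ i j, i + 1 < j → j < i + n → A i → A (i + 1) → A j →
    ¬ ∀ k, i + 1 < k → k < i + n → A k → k = j
  not_quad : ∀ i, A i → A (i + 3) → ¬ ∀ k, i + 3 < k → k < i + n → ¬ A k

/-- The properties of the neighbour sets of two nonadjacent major vertices. -/
structure MajorPair (n : ℤ) (A B : ℤ → Prop) : Prop where
  odd : n % 2 = 1
  left : MajorTrace n A
  right : MajorTrace n B
  cross : ∀ a b c d, Link A B a b ∨ Link B A a b → Link A B c d ∨ Link B A c d →
    (b - a) % 2 = 1 → (d - c) % 2 = 0 → b + 2 ≤ c → d + 2 ≤ a + n →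
    n ≤ (b - a) + (d - c) + 4

lemma Int.exists_first_of_le {A : ℤ → Prop} {p q : ℤ} (hpq : p ≤ q) (hq : A q) :
    ∃ t, p ≤ t ∧ t ≤ q ∧ A t ∧ ∀ k, p ≤ k → k < t → ¬ A k := by
  classical
  obtain ⟨t, ⟨h1, h2⟩, h3⟩ := Int.exists_least_of_bdd (P := fun t => p ≤ t ∧ A t)
    ⟨p, fun z hz => hz.1⟩ ⟨q, hpq, hq⟩
  refine ⟨t, h1, h3 q ⟨hpq, hq⟩, h2, fun k hk hkt hA => ?_⟩
  have := h3 k ⟨hk, hA⟩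
  omega

lemma Int.exists_last_of_le {A : ℤ → Prop} {p q : ℤ} (hpq : p ≤ q) (hp : A p) :
    ∃ t, p ≤ t ∧ t ≤ q ∧ A t ∧ ∀ k, t < k → k ≤ q → ¬ A k := by
  classical
  obtain ⟨t, ⟨h1, h2⟩, h3⟩ := Int.exists_greatest_of_bdd (P := fun t => t ≤ q ∧ A t)
    ⟨q, fun z hz => hz.1⟩ ⟨p, hpq, hp⟩
  refine ⟨t, h3 p ⟨hpq, hp⟩, h1, h2, fun k hk hkt hA => ?_⟩
  have := h3 k ⟨hkt, hA⟩
  omega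

namespace Link

variable {A B : ℤ → Prop} {a b : ℤ}

lemma exists_first {p q : ℤ} (hpq : p ≤ q) (hp : A p) (hq : B q) :
    ∃ s t, p ≤ s ∧ s ≤ t ∧ t ≤ q ∧ Link A B s t ∧ ∀ k, p ≤ k → k < t → ¬ B k := by
  obtain ⟨t, h1, h2, h3, h4⟩ := Int.exists_first_of_le hpq hq
  obtain ⟨s, h5, h6, h7, h8⟩ := Int.exists_last_of_le h1 hp
  refine ⟨s, t, h5, h6, h2, ⟨h6, h7, h3, fun k hk hkt => ⟨fun hA => ?_, fun hB => ?_⟩⟩, h4⟩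
  · by_contra hne
    exact h8 k (by omega) hkt hA
  · by_contra hne
    exact h4 k (by omega) (by omega) hB

lemma exists_last {p q : ℤ} (hpq : p ≤ q) (hp : A p) (hq : B q) :
    ∃ s t, p ≤ s ∧ s ≤ t ∧ t ≤ q ∧ Link A B s t ∧ ∀ k, s < k → k ≤ q → ¬ A k := by
  obtain ⟨s, h1, h2, h3, h4⟩ := Int.exists_last_of_le hpq hp
  obtain ⟨t, h5, h6, h7, h8⟩ := Int.exists_first_of_le h2 hq
  refine ⟨s, t, h1, h5, h6, ⟨h5, h3, h7, fun k hk hkt => ⟨fun hA => ?_, fun hB => ?_⟩⟩, h4⟩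
  · by_contra hne
    exact h4 k (by omega) (by omega) hA
  · by_contra hne
    exact h8 k hk (by omega) hB

lemma of_common {k : ℤ} (hA : A k) (hB : B k) : Link A B k k :=
  ⟨le_rfl, hA, hB, fun _ h1 h2 => ⟨fun _ => le_antisymm h2 h1, fun _ => le_antisymm h2 h1⟩⟩

lemma not_left (h : Link A B a b) {k : ℤ} (h1 : a < k) (h2 : k ≤ b) : ¬ A k := fun hk => by
  have := (h.2.2.2 k h1.le h2).1 hk
  omega

lemma not_right (h : Link A B a b) {k : ℤ} (h1 : a ≤ k) (h2 : k < b) : ¬ B k := fun hk => by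
  have := (h.2.2.2 k h1 h2.le).2 hk
  omega

lemma neg (h : Link A B a b) : Link (fun k => B (-k)) (fun k => A (-k)) (-b) (-a) := by
  obtain ⟨h1, h2, h3, h4⟩ := h
  refine ⟨by omega, by simpa, by simpa, fun k hk1 hk2 => ⟨fun hB => ?_, fun hA => ?_⟩⟩
  · have := (h4 (-k) (by omega) (by omega)).2 hB
    omega
  · have := (h4 (-k) (by omega) (by omega)).1 hA
    omega

lemma add_period {n : ℤ} (hA : ∀ k, A (k + n) ↔ A k) (hB : ∀ k, B (k + n) ↔ B k)
    (h : Link A B a b) : Link A B (a + n) (b + n) := by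
  obtain ⟨h1, h2, h3, h4⟩ := h
  refine ⟨by omega, (hA a).2 h2, (hB b).2 h3, fun k hk1 hk2 => ?_⟩
  have hA' := hA (k - n)
  have hB' := hB (k - n)
  rw [sub_add_cancel] at hA' hB'
  have := h4 (k - n) (by omega) (by omega)
  rw [hA', hB']
  exact ⟨fun h => by have := this.1 h; omega, fun h => by have := this.2 h; omega⟩

end Link

lemma MajorTrace.neg {n : ℤ} {A : ℤ → Prop} (h : MajorTrace n A) :
    MajorTrace n (fun k => A (-k)) where
  periodic k := by
    have := h.periodic (-k - n)
    rw [sub_add_cancel] at this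
    rw [this, neg_add, sub_eq_add_neg]
  gap i j hij hi hj hk ho := by
    have := h.gap (-j) (-i) (by omega) hj hi
      (fun k h1 h2 hA => hk (-k) (by omega) (by omega) (by simpa using hA)) (by omega)
    omega
  major i := by
    obtain ⟨k, h1, h2, h3⟩ := h.major (-i)
    have := h.periodic (k - n)
    rw [sub_add_cancel] at this
    refine ⟨n - k, by omega, by omega, ?_⟩
    rw [neg_sub]
    exact this.1 h3
  not_triple i j h1 h2 h3 h4 h5 h6 := by
    have hp := h.periodic (-j)
    refine h.not_triple (-i - 1) (-j + n) (by omega) (by omega) ?_ ?_ (hp.2 h5) ?_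
    · rwa [show -i - 1 = -(i + 1) by ring]
    · simpa using h3
    · intro k hk1 hk2 hk
      have hp := h.periodic (k - n)
      rw [sub_add_cancel] at hp
      have := h6 (n - k) (by omega) (by omega) (by rw [neg_sub]; exact hp.1 hk)
      omega
  not_quad i h1 h2 h3 := by
    refine h.not_quad (-i - 3) ?_ ?_ ?_
    · rwa [show -i - 3 = -(i + 3) by ring]
    · simpa using h1
    · intro k hk1 hk2 hk
      have hp := h.periodic (k - n)
      rw [sub_add_cancel] at hp
      exact h3 (n - k) (by omega) (by omega) (by rw [neg_sub]; exact hp.1 hk)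

/-- Periodic shift by one period to the left. -/
lemma MajorTrace.sub_period {n : ℤ} {A : ℤ → Prop} (h : MajorTrace n A) (k : ℤ) :
    A (k - n) ↔ A k := by
  rw [← h.periodic (k - n), sub_add_cancel]

lemma MajorTrace.emod_iff {n : ℤ} {A : ℤ → Prop} (h : MajorTrace n A) (a k : ℤ) :
    A (a + (k - a) % n) ↔ A k := by
  have hp : Function.Periodic A n := fun k => propext (h.periodic k)
  have := hp.int_mul ((k - a) / n) (a + (k - a) % n)
  rw [← this, Int.cast_id, add_assoc, mul_comm, Int.emod_add_mul_ediv, add_sub_cancel]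

namespace MajorPair

variable {n : ℤ} {A B : ℤ → Prop} {a b c d : ℤ}

lemma symm (h : MajorPair n A B) : MajorPair n B A :=
  ⟨h.odd, h.right, h.left, fun a b c d h1 h2 => h.cross a b c d h1.symm h2.symm⟩

lemma neg (h : MajorPair n A B) : MajorPair n (fun k => A (-k)) (fun k => B (-k)) where
  odd := h.odd
  left := h.left.neg
  right := h.right.neg
  cross a b c d h1 h2 h3 h4 h5 h6 := by
    have key : ∀ {p q : ℤ}, (Link (fun k => A (-k)) (fun k => B (-k)) p q ∨
        Link (fun k => B (-k)) (fun k => A (-k)) p q) →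
        Link A B (-q) (-p) ∨ Link B A (-q) (-p) := by
      rintro p q (h | h)
      · right; simpa using h.neg
      · left; simpa using h.neg
    have h2' := (key h2).imp (Link.add_period h.left.periodic h.right.periodic)
      (Link.add_period h.right.periodic h.left.periodic)
    have := h.cross _ _ _ _ (key h1) h2' (by omega) (by omega) (by omega) (by omega)
    omega

/-- An odd link and an even link cannot be disjoint with no edges between them. -/
lemma false_of_far_left (h : MajorPair n A B) (hP : Link A B a b)
    (hE : Link A B c d ∨ Link B A c d)
    (hodd : (b - a) % 2 = 1) (heven : (d - c) % 2 = 0) (h1 : b + 2 ≤ c) (h2 : d + 2 ≤ a + n) :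
    False := by
  have hn := h.odd
  have hlen := h.cross a b c d (Or.inl hP) hE hodd heven h1 h2
  obtain rfl : c = b + 2 := by have := hP.1; rcases hE with hE | hE <;> have := hE.1 <;> omega
  obtain rfl : d = a + n - 2 := by omega
  have hab := hP.1
  have hE' : Link A B (b + 2) (a + n - 2) ∨ Link B A (b + 2) (a + n - 2) ∧ b + 2 < a + n - 2 := by
    rcases hE with hE | hE
    · exact Or.inl hE
    · rcases hE.1.lt_or_eq with hlt | heq
      · exact Or.inr ⟨hE, hlt⟩
      · rw [← heq] at hE ⊢
        exact Or.inl (Link.of_common hE.2.2.1 hE.2.1)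
  rcases hE' with hE | ⟨hE, hlt⟩
  · have hA1 : A (b + 1) := by
      by_contra hA1
      have := h.left.gap a (b + 2) (by omega) hP.2.1 hE.2.1 (fun k hk1 hk2 => by
        rcases lt_or_ge b k with hk | hk
        · obtain rfl : k = b + 1 := by omega
          exact hA1
        · exact hP.not_left hk1 hk) (by omega)
      omega
    have hA0 : A (a + n) := (h.left.periodic a).2 hP.2.1
    by_cases hA2 : A (a + n - 1)
    · have := h.left.gap (b + 2) (a + n - 1) (by have := hE.1; omega) hE.2.1 hA2
        (fun k hk1 hk2 => hE.not_left hk1 (by omega)) (by omega)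
      refine h.left.not_quad (b + 1) hA1 ?_ ?_
      · rwa [show b + 1 + 3 = a + n by omega]
      · intro k hk1 hk2
        rw [← h.left.sub_period]
        exact hP.not_left (by omega) (by omega)
    · refine h.left.not_triple (b + 1) (a + n) (by have := hE.1; omega) (by omega) hA1 ?_ hA0 ?_
      · rw [show b + 1 + 1 = b + 2 by ring]; exact hE.2.1
      · intro k hk1 hk2 hk
        by_contra hne
        rcases lt_or_ge (a + n) k with hk3 | hk3
        · rw [← h.left.sub_period] at hk
          exact hP.not_left (by omega) (by omega) hk
        rcases le_or_gt k (a + n - 2) with hk4 | hk4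
        · exact hE.not_left (by omega) hk4 hk
        · obtain rfl : k = a + n - 1 := by omega
          exact hA2 hk
  · by_cases hA1 : A (b + 1)
    · have := h.left.gap (b + 1) (a + n - 2) (by omega) hA1 hE.2.2.1
        (fun k hk1 hk2 => hE.not_right (by omega) (by omega)) (by omega)
      omega
    · have := h.left.gap a (a + n - 2) (by omega) hP.2.1 hE.2.2.1
        (fun k hk1 hk2 => by
          rcases le_or_gt k b with hk | hk
          · exact hP.not_left hk1 hk
          · rcases lt_or_ge (b + 1) k with hk' | hk'
            · exact hE.not_right (by omega) (by omega)
            · obtain rfl : k = b + 1 := by omega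
              exact hA1) (by omega)
      omega

lemma false_of_far (h : MajorPair n A B) (hP : Link A B a b ∨ Link B A a b)
    (hE : Link A B c d ∨ Link B A c d)
    (hodd : (b - a) % 2 = 1) (heven : (d - c) % 2 = 0) (h1 : b + 2 ≤ c) (h2 : d + 2 ≤ a + n) :
    False := by
  rcases hP with hP | hP
  · exact h.false_of_far_left hP hE hodd heven h1 h2
  · exact h.symm.false_of_far_left hP hE.symm hodd heven h1 h2

/-- As `false_of_far`, with the even link preceding the odd one. -/
lemma false_of_far' (h : MajorPair n A B) (hP : Link A B a b ∨ Link B A a b)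
    (hE : Link A B c d ∨ Link B A c d)
    (hodd : (b - a) % 2 = 1) (heven : (d - c) % 2 = 0) (h1 : d + 2 ≤ a) (h2 : b + 2 ≤ c + n) :
    False :=
  h.false_of_far hP (hE.imp (Link.add_period h.left.periodic h.right.periodic)
    (Link.add_period h.right.periodic h.left.periodic)) hodd (by omega) (by omega) (by omega)

/-- Vertices adjacent to both major vertices lie next to every odd link. -/
lemma eq_of_common (h : MajorPair n A B) (hP : Link A B a b ∨ Link B A a b)
    (hodd : (b - a) % 2 = 1) {k : ℤ} (h1 : b < k) (h2 : k < a + n) (hA : A k) (hB : B k) :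
    k = b + 1 ∨ k = a + n - 1 := by
  by_contra hne
  exact h.false_of_far hP (Or.inl (Link.of_common hA hB)) hodd (by omega) (by omega) (by omega)

lemma false_of_common_both (h : MajorPair n A B) (hP : Link A B a b) (hodd : (b - a) % 2 = 1)
    (hA1 : A (b + 1)) (hB1 : B (b + 1)) (hA2 : A (a + n - 1)) (hB2 : B (a + n - 1))
    (hn : b + 2 < a + n) :
    False := by
  have hno := h.odd
  have hab := hP.1
  have key : ∀ s t, Link A B s t ∨ Link B A s t → b + 2 ≤ s → s ≤ t → t ≤ a + n - 2 → False := by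
    intro s t hst h1 h2 h3
    rcases Int.emod_two_eq_zero_or_one (t - s) with he | ho
    · exact h.false_of_far (Or.inl hP) hst hodd he h1 (by omega)
    · have hs : s = b + 2 := by
        by_contra hne
        exact h.false_of_far' hst (Or.inl (Link.of_common hA1 hB1)) ho (by omega)
          (by omega) (by omega)
      have ht : t = a + n - 2 := by
        by_contra hne
        exact h.false_of_far hst (Or.inl (Link.of_common hA2 hB2)) ho (by omega)
          (by omega) (by omega)
      omega
  by_cases hA : ∃ k, b + 2 ≤ k ∧ k ≤ a + n - 2 ∧ A k
  · obtain ⟨k, hk1, hk2, hk⟩ := hA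
    refine h.right.not_triple b (a + n - 1) (by omega) (by omega) hP.2.2.1 hB1 hB2 ?_
    intro l hl1 hl2 hl
    by_contra hne
    rcases lt_or_ge l (a + n - 1) with hl3 | hl3
    · rcases le_total k l with hkl | hkl
      · obtain ⟨s, t, h1, h2, h3, h4, -⟩ := Link.exists_first hkl hk hl
        exact key s t (Or.inl h4) (by omega) h2 (by omega)
      · obtain ⟨s, t, h1, h2, h3, h4, -⟩ := Link.exists_first hkl hl hk
        exact key s t (Or.inr h4) (by omega) h2 (by omega)
    · rw [← h.right.sub_period] at hl
      exact hP.not_right (by omega) (by omega) hl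
  · push Not at hA
    have hA0 : A (a + n) := (h.left.periodic a).2 hP.2.1
    refine h.left.not_triple (a + n - 1) (b + 1 + n) (by omega) (by omega) hA2
      (by simpa using hA0) ((h.left.periodic _).2 hA1) ?_
    intro l hl1 hl2 hl
    by_contra hne
    rw [← h.left.sub_period] at hl
    rcases le_or_gt l (b + n) with hl3 | hl3
    · exact hP.not_left (by omega) (by omega) hl
    · exact hA _ (by omega) (by omega) hl

lemma false_of_common_left (h : MajorPair n A B) (hP : Link A B a b) (hodd : (b - a) % 2 = 1)
    (hA2 : A (a + n - 1)) (hB2 : B (a + n - 1)) (h1 : ¬ (A (b + 1) ∧ B (b + 1))) :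
    False := by
  have hno := h.odd
  have hab := hP.1
  have key : ∀ s t, Link A B s t ∨ Link B A s t → b ≤ s → (t - s) % 2 = 1 →
      a + n - 3 < t := fun s t hst h1 h2 => by
    by_contra h3
    exact h.false_of_far hst (Or.inl (Link.of_common hA2 hB2)) h2 (by omega) (by omega) (by omega)
  obtain ⟨k, hk1, hk2, hk⟩ := h.left.major a
  have hbk : b < k := by
    by_contra hbk
    exact hP.not_left (by omega) (by omega) hk
  obtain ⟨s, t, hs, hst, ht, hl, hfirst⟩ := Link.exists_first hbk.le hP.2.2.1 hk
  have hAb : ¬ A b := hP.not_left (by omega) le_rfl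
  have htb : b < t := by
    rcases (hs.trans hst).lt_or_eq with h2 | h2
    · exact h2
    · exact absurd (h2 ▸ hl.2.2.1) hAb
  have hta : (t - a) % 2 = 0 := by
    by_contra hta
    have := h.left.gap a t (by omega) hP.2.1 hl.2.2.1 (fun k h1 h2 => by
      rcases le_or_gt k b with h3 | h3
      · exact hP.not_left h1 h3
      · exact hfirst k h3.le h2) (by omega)
    omega
  have hst2 : (t - s) % 2 = 0 := by
    by_contra hst2
    have := key s t (Or.inr hl) hs (by omega)
    omega
  obtain rfl : s = b + 1 := by
    by_contra hne
    exact h.false_of_far (Or.inl hP) (Or.inr hl) hodd hst2 (by omega) (by omega)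
  have htb' : b + 1 ≠ t := by
    rintro rfl
    exact h1 ⟨hl.2.2.1, hl.2.1⟩
  refine h.right.not_triple b (a + n - 1) (by omega) (by omega) hP.2.2.1 hl.2.1 hB2 ?_
  intro l hl1 hl2 hlB
  by_contra hne
  rcases le_or_gt l t with hlt | hlt
  · exact hl.not_left hl1 hlt hlB
  rcases lt_or_ge l (a + n - 1) with hl3 | hl3
  · obtain ⟨s', t', hs', hst', ht', hl', hfirst'⟩ := Link.exists_first hlt.le hl.2.2.1 hlB
    rcases Int.emod_two_eq_zero_or_one (t' - s') with he | ho
    · exact h.false_of_far (Or.inl hP) (Or.inl hl') hodd he (by omega) (by omega)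
    · have := key s' t' (Or.inl hl') (by omega) ho
      have := h.right.gap (b + 1) t' (by omega) hl.2.1 hl'.2.2.1 (fun k hk1 hk2 => by
        rcases le_or_gt k t with h3 | h3
        · exact hl.not_left hk1 h3
        · exact hfirst' k h3.le hk2) (by omega)
      omega
  · rw [← h.right.sub_period] at hlB
    exact hP.not_right (by omega) (by omega) hlB

lemma exists_even_link (h : MajorPair n A B) (hP : Link A B a b) (hodd : (b - a) % 2 = 1)
    (hn : b < a + n) (hdisj : ∀ k, A k → ¬ B k) :
    ∃ c d, (Link A B c d ∨ Link B A c d) ∧ b ≤ c ∧ d ≤ a + n ∧ (d - c) % 2 = 0 := by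
  have hno := h.odd
  have hab := hP.1
  by_contra! hcon
  have parity : ∀ m : ℕ, ∀ s t, t = a + m → t ≤ a + n → 
      (Link A B s t → b ≤ s → (t - a) % 2 = 1) ∧ (Link B A s t → b ≤ s → (t - a) % 2 = 0) := by
    intro m
    induction m using Nat.strong_induction_on with
    | _ m ih =>
      intro s t htm htn
      constructor
      · intro hl hs
        have hst := hl.1
        obtain ⟨p, q, h1, h2, h3, h4, h5⟩ := Link.exists_last hs hP.2.2.1 hl.2.1
        have hps : p ≠ s := by rintro rfl; exact hdisj _ hl.2.1 h4.2.1
        have hst' : s ≠ t := by rintro rfl; exact hdisj _ hl.2.1 hl.2.2.1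
        have hq := (ih (q - a).toNat (by omega) p q (by omega) (by omega)).2 h4 h1
        have hqp := hcon p q (Or.inr h4) h1 (by omega)
        by_contra hpar
        have := h.right.gap p t (by omega) h4.2.1 hl.2.2.1 (fun k hk1 hk2 => by
          rcases le_or_gt k s with hk | hk
          · exact h5 k hk1 hk
          · exact hl.not_right hk.le hk2) (by omega)
        omega
      · intro hl hs
        have hst := hl.1
        obtain ⟨p, q, h1, h2, h3, h4, h5⟩ := Link.exists_last (hab.trans hs) hP.2.1 hl.2.1
        have hps : p ≠ s := by rintro rfl; exact hdisj _ h4.2.1 hl.2.1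
        have hst' : s ≠ t := by rintro rfl; exact hdisj _ hl.2.2.1 hl.2.1
        have hpa : (p - a) % 2 = 0 := by
          rcases lt_or_ge p b with hpb | hpb
          · have := (hP.2.2.2 p h1 hpb.le).1 h4.2.1
            omega
          · have hq := (ih (q - a).toNat (by omega) p q (by omega) (by omega)).1 h4 hpb
            have hqp := hcon p q (Or.inl h4) hpb (by omega)
            omega
        by_contra hpar
        have := h.left.gap p t (by omega) h4.2.1 hl.2.2.1 (fun k hk1 hk2 => by
          rcases le_or_gt k s with hk | hk
          · exact h5 k hk1 hk
          · exact hl.not_right hk.le hk2) (by omega)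
        omega
  have hA0 : A (a + n) := (h.left.periodic a).2 hP.2.1
  obtain ⟨p, q, h1, h2, h3, h4, h5⟩ := Link.exists_last hn.le hP.2.2.1 hA0
  have hpn : p ≠ a + n := by rintro rfl; exact hdisj _ hA0 h4.2.1
  have hq := (parity (q - a).toNat p q (by omega) h3).2 h4 h1
  have hqp := hcon p q (Or.inr h4) h1 h3
  have := h.right.gap p (b + n) (by omega) h4.2.1 ((h.right.periodic b).2 hP.2.2.1)
    (fun k hk1 hk2 => by
      rcases le_or_gt k (a + n) with hk | hk
      · exact h5 k hk1 hk
      · rw [← h.right.sub_period]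
        exact hP.not_right (by omega) (by omega)) (by omega)
  omega

lemma false_of_disjoint_of_near (h : MajorPair n A B) (hP : Link A B a b)
    (hodd : (b - a) % 2 = 1) (hdisj : ∀ k, A k → ¬ B k)
    (hE : Link A B c d ∨ Link B A c d) (heven : (d - c) % 2 = 0)
    (hbc : b ≤ c) (hcb : c ≤ b + 1) (hd : d ≤ a + n) : False := by
  have hno := h.odd
  have hab := hP.1
  have hAb : ¬ A b := hP.not_left (by omega) le_rfl
  have hcd : c < d := by
    rcases hE with hE | hE <;> rcases hE.1.lt_or_eq with h1 | rfl
    · exact h1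
    · exact absurd hE.2.2.1 (hdisj _ hE.2.1)
    · exact h1
    · exact absurd hE.2.1 (hdisj _ hE.2.2.1)
  obtain ⟨rfl, hE⟩ : c = b + 1 ∧ Link B A c d := by
    rcases hE with hE | hE
    · have hcb' : c ≠ b := by rintro rfl; exact hAb hE.2.1
      have := h.right.gap b d (by omega) hP.2.2.1 hE.2.2.1
        (fun k hk1 hk2 => hE.not_right (by omega) hk2) (by omega)
      omega
    · refine ⟨?_, hE⟩
      by_contra hne
      have := h.left.gap a d (by omega) hP.2.1 hE.2.2.1
        (fun k hk1 hk2 => by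
          rcases le_or_gt k b with hk | hk
          · exact hP.not_left hk1 hk
          · exact hE.not_right (by omega) hk2) (by omega)
      omega
  obtain ⟨k, hk1, hk2, hk⟩ := h.right.major (b + 1)
  have hdk : d < k := by
    by_contra hdk
    exact hE.not_left (by omega) (by omega) hk
  have hkn : k < a + n := by
    by_contra hkn
    rw [← h.right.sub_period] at hk
    exact hP.not_right (by omega) (by omega) hk
  -- the next link, from `A` to `B`
  obtain ⟨s, t, hs, hst, htk, hl, hfirst⟩ := Link.exists_first hdk.le hE.2.2.1 hk
  have hdt : d ≠ t := by rintro rfl; exact hdisj _ hE.2.2.1 hl.2.2.1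
  have hst' : s ≠ t := by rintro rfl; exact hdisj _ hl.2.1 hl.2.2.1
  have hBt : ∀ k, b + 1 < k → k < t → ¬ B k := fun k hk1 hk2 => by
    rcases le_or_gt k d with hk | hk
    · exact hE.not_left hk1 hk
    · exact hfirst k hk.le hk2
  have htb : (t - (b + 1)) % 2 = 0 := by
    by_contra hpar
    have := h.right.gap (b + 1) t (by omega) hE.2.1 hl.2.2.1 hBt (by omega)
    omega
  have htn : t ≤ a + n - 2 := by
    by_contra hcon
    refine h.right.not_triple b t (by omega) (by omega) hP.2.2.1 hE.2.1 hl.2.2.1 ?_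
    intro k hk1 hk2 hk
    by_contra hne
    rcases lt_or_ge k t with hkt | hkt
    · exact hBt k hk1 hkt hk
    · rw [← h.right.sub_period] at hk
      exact hP.not_right (by omega) (by omega) hk
  have hlo : (t - s) % 2 = 1 := by
    by_contra hpar
    exact h.false_of_far (Or.inl hP) (Or.inl hl) hodd (by omega) (by omega) (by omega)
  obtain rfl : s = d + 1 := by
    by_contra hne
    exact h.false_of_far' (Or.inl hl) (Or.inr hE) hlo heven (by omega) (by omega)
  obtain ⟨k, hk1, hk2, hk⟩ : ∃ k, t < k ∧ k < a + n ∧ A k := by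
    by_contra! hcon
    refine h.left.not_triple d (a + n) (by omega) (by omega) hE.2.2.1 hl.2.1
      ((h.left.periodic a).2 hP.2.1) ?_
    intro k hk1 hk2 hk
    by_contra hne
    rcases le_or_gt k t with hkt | hkt
    · exact hl.not_left hk1 hkt hk
    rcases lt_or_ge k (a + n) with hkn | hkn
    · exact hcon k hkt hkn hk
    rw [← h.left.sub_period] at hk
    rcases le_or_gt (k - n) b with hkb | hkb
    · exact hP.not_left (by omega) hkb hk
    · exact hE.not_right (by omega) (by omega) hk
  -- the link after that, from `B` to `A`
  obtain ⟨g, e, hg, hge, hek, hl', hfirst'⟩ := Link.exists_first hk1.le hl.2.2.1 hk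
  have hte : t ≠ e := by rintro rfl; exact hdisj _ hl'.2.2.1 hl.2.2.1
  have hge2 : (e - g) % 2 = 0 := by
    by_contra hpar
    exact h.false_of_far' (Or.inr hl') (Or.inr hE) (by omega) heven (by omega) (by omega)
  obtain rfl : e = a + n - 1 := by
    by_contra hne
    exact h.false_of_far (Or.inl hP) (Or.inr hl') hodd hge2 (by omega) (by omega)
  have hgt : g ≤ t + 1 := by
    by_contra hcon
    exact h.false_of_far (Or.inl hl) (Or.inr hl') hlo hge2 (by omega) (by omega)
  have he : (a + n - 1 - (d + 1)) % 2 = 0 := by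
    by_contra hpar
    have := h.left.gap (d + 1) (a + n - 1) (by omega) hl.2.1 hl'.2.2.1 (fun k hk1 hk2 => by
      rcases le_or_gt k t with hk | hk
      · exact hl.not_left hk1 hk
      · exact hfirst' k hk.le hk2) (by omega)
    omega
  have := h.right.gap g (b + n) (by omega) hl'.2.1 ((h.right.periodic b).2 hP.2.2.1)
    (fun k hk1 hk2 => by
      rcases le_or_gt k (a + n - 1) with hk | hk
      · exact hl'.not_left hk1 hk
      · rw [← h.right.sub_period]
        exact hP.not_right (by omega) (by omega)) (by omega)
  omega

/-- Two nonadjacent major vertices admit no odd link. -/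
theorem not_odd_link (h : MajorPair n A B) (hP : Link A B a b) (hodd : (b - a) % 2 = 1) :
    False := by
  have hno := h.odd
  have hab := hP.1
  have hbn : b + 2 < a + n := by
    obtain ⟨k, hk1, hk2, hk⟩ := h.left.major a
    by_contra hcon
    exact hP.not_left (by omega) (by omega) hk
  by_cases h1 : A (b + 1) ∧ B (b + 1)
  · by_cases h2 : A (a + n - 1) ∧ B (a + n - 1)
    · exact h.false_of_common_both hP hodd h1.1 h1.2 h2.1 h2.2 hbn
    · have hn := Link.add_period h.neg.right.periodic h.neg.left.periodic hP.neg
      refine h.neg.symm.false_of_common_left hP.neg (by omega) ?_ ?_ ?_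
      · have := (h.right.periodic (b + 1 - n)).1 (by simpa using h1.2)
        rwa [show -(-b + n - 1) = b + 1 - n by ring]
      · have := (h.left.periodic (b + 1 - n)).1 (by simpa using h1.1)
        rwa [show -(-b + n - 1) = b + 1 - n by ring]
      · intro h3
        rw [show -(-a + 1) = a + n - 1 - n by ring, h.left.sub_period, h.right.sub_period] at h3
        exact h2 h3.symm
  by_cases h2 : A (a + n - 1) ∧ B (a + n - 1)
  · exact h.false_of_common_left hP hodd h2.1 h2.2 h1
  have hdisj : ∀ k, A k → ¬ B k := by
    intro k hA hB
    rw [← h.left.emod_iff a] at hA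
    rw [← h.right.emod_iff a] at hB
    have hk1 := Int.emod_nonneg (k - a) (show n ≠ 0 by omega)
    have hk2 := Int.emod_lt_of_pos (k - a) (show 0 < n by omega)
    obtain ⟨l, hl⟩ : ∃ l, l = a + (k - a) % n := ⟨_, rfl⟩
    rw [← hl] at hA hB
    rcases le_or_gt l b with hlb | hlb
    · have := (hP.2.2.2 l (by omega) hlb).1 hA
      have := (hP.2.2.2 l (by omega) hlb).2 hB
      omega
    · rcases h.eq_of_common (Or.inl hP) hodd hlb (by omega) hA hB with rfl | rfl
      · exact h1 ⟨hA, hB⟩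
      · exact h2 ⟨hA, hB⟩
  obtain ⟨c, d, hE, hbc, hdn, heven⟩ := h.exists_even_link hP hodd (by omega) hdisj
  by_cases hc : c ≤ b + 1
  · exact h.false_of_disjoint_of_near hP hodd hdisj hE heven hbc hc hdn
  by_cases hd : d + 2 ≤ a + n
  · exact h.false_of_far (Or.inl hP) hE hodd heven (by omega) hd
  refine h.neg.symm.false_of_disjoint_of_near (c := -d + n) (d := -c + n) hP.neg (by omega)
    (fun k hB hA => hdisj _ hA hB) ?_ (by omega) (by omega) (by omega) (by omega)
  exact hE.imp
    (fun hE => Link.add_period h.neg.right.periodic h.neg.left.periodic hE.neg)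
    (fun hE => Link.add_period h.neg.left.periodic h.neg.right.periodic hE.neg)

end MajorPair
/-- The vertices `p 0, …, p k` form an induced path, in this order. -/
def IsInducedSeq (G : SimpleGraph V) (k : ℕ) (p : ℕ → V) : Prop :=
  ∀ i j, i < j → j ≤ k → p i ≠ p j ∧ (G.Adj (p i) (p j) ↔ j = i + 1)

lemma IsInducedSeq.isInducedPathMap {G : SimpleGraph V} {k : ℕ} {p : ℕ → V}
    (h : IsInducedSeq G k p) : IsInducedPathMap G k (fun i => p i) := by
  refine ⟨fun i j hij => ?_, fun i j => ?_⟩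
  · by_contra hne
    rcases Ne.lt_or_gt hne with hlt | hlt
    · exact (h i j hlt (by omega)).1 hij
    · exact (h j i hlt (by omega)).1 hij.symm
  · rcases lt_trichotomy i j with hlt | rfl | hlt
    · rw [(h i j hlt (by omega)).2]
      have : i.val < j.val := hlt
      omega
    · simp
    · rw [G.adj_comm, (h j i hlt (by omega)).2]
      have : j.val < i.val := hlt
      omega

lemma isHole_of_seq {G : SimpleGraph V} {m : ℕ} {g : ℕ → V} (hm : 4 ≤ m)
    (h : ∀ i j, i < j → j < m →
      g i ≠ g j ∧ (G.Adj (g i) (g j) ↔ j = i + 1 ∨ i = 0 ∧ j + 1 = m)) :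
    IsHole G m (fun z => g z.val) := by
  have : NeZero m := ⟨by omega⟩
  have : Fact (1 < m) := ⟨by omega⟩
  have hsucc : ∀ i j : ZMod m, j = i + 1 ↔ (j.val = i.val + 1 ∨ j.val = 0 ∧ i.val + 1 = m) := by
    intro i j
    have hi := i.val_lt
    have hj := j.val_lt
    rw [← (ZMod.val_injective m).eq_iff, ZMod.val_add, ZMod.val_one]
    rcases Nat.lt_or_ge (i.val + 1) m with hlt | hge
    · rw [Nat.mod_eq_of_lt hlt]
      omega
    · rw [show i.val + 1 = m by omega, Nat.mod_self]
      omega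
  refine ⟨hm, fun i j hij => ?_, fun i j => ?_⟩
  · by_contra hne
    have hne' : i.val ≠ j.val := fun h => hne (ZMod.val_injective m h)
    rcases Ne.lt_or_gt hne' with hlt | hlt
    · exact (h _ _ hlt j.val_lt).1 hij
    · exact (h _ _ hlt i.val_lt).1 hij.symm
  · have hi := i.val_lt
    have hj := j.val_lt
    rw [hsucc, hsucc]
    rcases lt_trichotomy i.val j.val with hlt | heq | hlt
    · rw [(h _ _ hlt j.val_lt).2]
      omega
    · simp only [heq, SimpleGraph.irrefl, false_iff]
      omega
    · rw [G.adj_comm, (h _ _ hlt i.val_lt).2]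
      omega

/-- An induced path together with a vertex adjacent exactly to its ends is a hole. -/
lemma isHole_of_path {G : SimpleGraph V} {k : ℕ} {p : ℕ → V} {x : V} (hk : 2 ≤ k)
    (hp : IsInducedSeq G k p) (hx : ∀ i ≤ k, x ≠ p i ∧ (G.Adj x (p i) ↔ i = 0 ∨ i = k)) :
    IsHole G (k + 2) (fun z => if z.val ≤ k then p z.val else x) := by
  refine isHole_of_seq (g := fun i => if i ≤ k then p i else x) (by omega) fun i j hij hj => ?_
  rw [if_pos (show i ≤ k by omega)]
  by_cases hjk : j ≤ k
  · rw [if_pos hjk, (hp i j hij hjk).2]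
    exact ⟨(hp i j hij hjk).1, by omega⟩
  · rw [if_neg hjk, G.adj_comm, (hx i (by omega)).2]
    exact ⟨(hx i (by omega)).1.symm, by omega⟩

/-- Two induced paths with no edges between them, joined by two nonadjacent vertices each
adjacent exactly to one end of either path, form a hole. -/
lemma isHole_of_two_paths {G : SimpleGraph V} {k l : ℕ} {p q : ℕ → V} {x y : V}
    (hp : IsInducedSeq G k p) (hq : IsInducedSeq G l q)
    (hpq : ∀ i ≤ k, ∀ j ≤ l, p i ≠ q j ∧ ¬ G.Adj (p i) (q j))
    (hne : x ≠ y) (hxy : ¬ G.Adj x y)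
    (hxp : ∀ i ≤ k, x ≠ p i ∧ (G.Adj x (p i) ↔ i = 0))
    (hyp : ∀ i ≤ k, y ≠ p i ∧ (G.Adj y (p i) ↔ i = k))
    (hyq : ∀ j ≤ l, y ≠ q j ∧ (G.Adj y (q j) ↔ j = 0))
    (hxq : ∀ j ≤ l, x ≠ q j ∧ (G.Adj x (q j) ↔ j = l)) :
    ∃ g : ZMod (k + l + 4) → V, IsHole G (k + l + 4) g := by
  let g : ℕ → V := fun i =>
    if i ≤ k then p i else if i = k + 1 then y else if i ≤ k + l + 2 then q (i - (k + 2)) else x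
  have g1 : ∀ i, i ≤ k → g i = p i := fun i hi => if_pos hi
  have g2 : g (k + 1) = y := by simp [g]
  have g3 : ∀ i, k + 2 ≤ i → i ≤ k + l + 2 → g i = q (i - (k + 2)) := fun i h1 h2 => by
    simp only [g]
    rw [if_neg (by omega), if_neg (by omega), if_pos h2]
  have g4 : g (k + l + 3) = x := by
    simp only [g]
    rw [if_neg (by omega), if_neg (by omega), if_neg (by omega)]
  refine ⟨_, isHole_of_seq (g := g) (by omega) fun i j hij hj => ?_⟩
  rcases Nat.lt_or_ge k j with hkj | hkj
  swap
  · rw [g1 i (by omega), g1 j hkj, (hp i j hij hkj).2]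
    exact ⟨(hp i j hij hkj).1, by omega⟩
  rcases eq_or_ne j (k + 1) with rfl | hj1
  · rw [g1 i (by omega), g2, G.adj_comm, (hyp i (by omega)).2]
    exact ⟨(hyp i (by omega)).1.symm, by omega⟩
  rcases Nat.lt_or_ge (k + l + 2) j with hj2 | hj2
  · obtain rfl : j = k + l + 3 := by omega
    rw [g4, G.adj_comm]
    rcases Nat.lt_or_ge k i with hki | hki
    swap
    · rw [g1 i hki, (hxp i hki).2]
      exact ⟨(hxp i hki).1.symm, by omega⟩
    rcases eq_or_ne i (k + 1) with rfl | hi1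
    · rw [g2]
      exact ⟨hne.symm, iff_of_false hxy (by omega)⟩
    · rw [g3 i (by omega) (by omega), (hxq _ (by omega)).2]
      exact ⟨(hxq _ (by omega)).1.symm, by omega⟩
  · rw [g3 j (by omega) hj2]
    rcases Nat.lt_or_ge k i with hki | hki
    swap
    · rw [g1 i hki]
      have := hpq i hki (j - (k + 2)) (by omega)
      exact ⟨this.1, iff_of_false this.2 (by omega)⟩
    rcases eq_or_ne i (k + 1) with rfl | hi1
    · rw [g2, (hyq _ (by omega)).2]
      exact ⟨(hyq _ (by omega)).1, by omega⟩
    · rw [g3 i (by omega) (by omega)]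
      have := hq (i - (k + 2)) (j - (k + 2)) (by omega) (by omega)
      rw [this.2]
      exact ⟨this.1, by omega⟩

/-- A shortest odd hole of length `n`, unrolled to a periodic sequence indexed by `ℤ`. -/
structure IsUnrolled (G : SimpleGraph V) (n : ℤ) (c : ℤ → V) : Prop where
  five_le : 5 ≤ n
  odd : n % 2 = 1
  periodic : ∀ k, c (k + n) = c k
  ne : ∀ i j, i < j → j < i + n → c i ≠ c j
  adj : ∀ i j, i < j → j < i + n → (G.Adj (c i) (c j) ↔ j = i + 1 ∨ j = i + n - 1)
  shortest : ∀ (m : ℕ) (g : ZMod m → V), IsOddHole G m g → n ≤ m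

lemma IsShortestOddHole.isUnrolled {G : SimpleGraph V} {n : ℕ} {f : ZMod n → V}
    (h : IsShortestOddHole G n f) : IsUnrolled G n (fun k : ℤ => f k) := by
  obtain ⟨⟨⟨h4, hinj, hadj⟩, hodd⟩, hmin⟩ := h
  have hodd' := Nat.odd_iff.1 hodd
  refine ⟨by omega, by omega, fun k => by simp, fun i j hij hj he => ?_, fun i j hij hj => ?_,
    fun m g hg => by exact_mod_cast hmin m g hg⟩
  · have := (ZMod.intCast_eq_intCast_iff_dvd_sub i j n).1 (hinj he)
    have := Int.le_of_dvd (by omega) this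
    omega
  · rw [hadj]
    have e1 : (j : ZMod n) = (i : ZMod n) + 1 ↔ (n : ℤ) ∣ j - (i + 1) := by
      rw [← ZMod.intCast_eq_intCast_iff_dvd_sub]
      push_cast
      exact eq_comm
    have e2 : (i : ZMod n) = (j : ZMod n) + 1 ↔ (n : ℤ) ∣ (j + 1) - i := by
      rw [← ZMod.intCast_eq_intCast_iff_dvd_sub]
      push_cast
      rfl
    rw [e1, e2]
    constructor
    · rintro (h | h)
      · rcases (show 0 ≤ j - (i + 1) by omega).lt_or_eq with h0 | h0
        · have := Int.le_of_dvd h0 h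
          omega
        · omega
      · have := Int.le_of_dvd (by omega) h
        omega
    · rintro (h | h)
      · left; rw [h]; simp
      · right; rw [h]; simp

namespace IsUnrolled

variable {G : SimpleGraph V} {n : ℤ} {c : ℤ → V}

lemma seq_up (h : IsUnrolled G n c) (a : ℤ) {k : ℕ} (hk : (k : ℤ) + 2 ≤ n) :
    IsInducedSeq G k (fun i => c (a + i)) := fun i j hij hj =>
  ⟨h.ne _ _ (by omega) (by omega), by
    rw [h.adj _ _ (by omega) (by omega)]
    omega⟩

lemma seq_down (h : IsUnrolled G n c) (b : ℤ) {k : ℕ} (hk : (k : ℤ) + 2 ≤ n) :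
    IsInducedSeq G k (fun i => c (b - i)) := fun i j hij hj =>
  ⟨(h.ne _ _ (by omega) (by omega)).symm, by
    rw [G.adj_comm, h.adj _ _ (by omega) (by omega)]
    omega⟩

/-- A vertex off the hole whose neighbours on it are not contained in three consecutive
vertices. -/
def Major (G : SimpleGraph V) (n : ℤ) (c : ℤ → V) (x : V) : Prop :=
  (∀ k, x ≠ c k) ∧ ∀ i, ∃ k, i + 1 < k ∧ k < i + n - 1 ∧ G.Adj x (c k)

lemma trace_periodic (h : IsUnrolled G n c) (x : V) (k : ℤ) :
    G.Adj x (c (k + n)) ↔ G.Adj x (c k) := by rw [h.periodic]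

lemma gap (h : IsUnrolled G n c) {x : V} (hx : Major G n c x) (i j : ℤ) (hij : i < j)
    (hi : G.Adj x (c i)) (hj : G.Adj x (c j)) (hk : ∀ k, i < k → k < j → ¬ G.Adj x (c k))
    (ho : (j - i) % 2 = 1) : j = i + 1 := by
  by_contra hne
  have h5 := h.five_le
  have hn := h.odd
  have hjn : j ≤ i + n - 3 := by
    by_contra hcon
    rcases eq_or_ne j (i + n - 2) with rfl | hj2
    · obtain ⟨k, h1, h2, h3⟩ := hx.2 (i - 1)
      exact hk k (by omega) (by omega) h3
    · obtain ⟨k, h1, h2, h3⟩ := hx.2 i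
      exact hk k (by omega) (by omega) h3
  obtain ⟨l, hl⟩ : ∃ l : ℕ, (l : ℤ) = j - i := ⟨(j - i).toNat, by omega⟩
  have hole := isHole_of_path (x := x) (k := l) (by omega) (h.seq_up i (by omega))
    (fun t ht => ⟨hx.1 _, by
      constructor
      · intro hadj
        by_contra hcon
        exact hk _ (by omega) (by omega) hadj
      · rintro (rfl | rfl)
        · simpa using hi
        · rwa [hl, add_sub_cancel]⟩)
  have := h.shortest _ _ ⟨hole, Nat.odd_iff.2 (by omega)⟩
  push_cast at this
  omega

lemma not_triple (h : IsUnrolled G n c) (hP : ¬ ContainsPyramid G) {x : V}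
    (hx : Major G n c x) (i j : ℤ) (hij : i + 1 < j) (hj : j < i + n)
    (h1 : G.Adj x (c i)) (h2 : G.Adj x (c (i + 1))) (h3 : G.Adj x (c j)) :
    ¬ ∀ k, i + 1 < k → k < i + n → G.Adj x (c k) → k = j := by
  intro hall
  have h5 := h.five_le
  have hj1 : i + 2 < j := by
    obtain ⟨k, k1, k2, k3⟩ := hx.2 (i + 1)
    have := hall k (by omega) (by omega) k3
    omega
  have hj2 : j < i + n - 1 := by
    obtain ⟨k, k1, k2, k3⟩ := hx.2 i
    have := hall k (by omega) (by omega) k3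
    omega
  obtain ⟨k, hk⟩ : ∃ k : ℕ, (k : ℤ) = j - i - 1 := ⟨(j - i - 1).toNat, by omega⟩
  obtain ⟨l, hl⟩ : ∃ l : ℕ, (l : ℤ) = i + n - j := ⟨(i + n - j).toNat, by omega⟩
  have hci : c (i + n) = c i := h.periodic i
  have hseq : IsInducedSeq G 1 (fun t => if t = 0 then c j else x) := by
    intro s t hst ht
    obtain rfl : s = 0 := by omega
    obtain rfl : t = 1 := by omega
    simp [(hx.1 j).symm, h3.symm]
  refine hP ⟨c j, c (i + 1), c i, x, k, l, 1, _, _, _,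
    (h.seq_down j (k := k) (by omega)).isInducedPathMap,
    (h.seq_up j (k := l) (by omega)).isInducedPathMap, hseq.isInducedPathMap,
    by simp, by simp, by simp, ?_, ?_, by simp, h.ne _ _ hij (by omega),
    h.ne _ _ (by omega) (by omega), hx.1 j, ?_, h2.symm, h1.symm, Or.inl ⟨by omega, by omega⟩,
    ?_, ?_, ?_, ?_, ?_, ?_⟩
  · simp only [Fin.val_last]
    rw [hk]
    congr 1
    ring
  · simp [hl, hci]
  · rw [G.adj_comm, h.adj _ _ (by omega) (by omega)]
    omega
  · rintro _ ⟨⟨s, rfl⟩, ⟨t, ht⟩⟩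
    have hs := s.is_lt
    have ht' := t.is_lt
    simp only at ht
    by_contra hne
    have hs0 : (s : ℕ) ≠ 0 := fun h0 => hne (by simp [h0])
    exact h.ne (j - s) (j + t) (by omega) (by omega) ht.symm
  · rintro _ ⟨⟨s, rfl⟩, ⟨t, ht⟩⟩
    simp only at ht
    split_ifs at ht
    · exact ht.symm
    · exact absurd ht (hx.1 _)
  · rintro _ ⟨⟨s, rfl⟩, ⟨t, ht⟩⟩
    simp only at ht
    split_ifs at ht
    · exact ht.symm
    · exact absurd ht (hx.1 _)
  · rintro _ _ ⟨s, rfl⟩ ⟨t, rfl⟩ hs0 ht0 hadj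
    have hs := s.is_lt
    have ht := t.is_lt
    have hs1 : (s : ℕ) ≠ 0 := fun h0 => hs0 (by simp [h0])
    have ht1 : (t : ℕ) ≠ 0 := fun h0 => ht0 (by simp [h0])
    rw [h.adj _ _ (by omega) (by omega)] at hadj
    beta_reduce
    rw [show j - (s : ℕ) = i + 1 by omega, show j + (t : ℕ) = i + n by omega]
    exact ⟨rfl, hci⟩
  · rintro _ _ ⟨s, rfl⟩ ⟨t, rfl⟩ hs0 ht0 hadj
    have hs := s.is_lt
    have hs1 : (s : ℕ) ≠ 0 := fun h0 => hs0 (by simp [h0])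
    beta_reduce at ht0 hadj ⊢
    split_ifs at ht0 hadj ⊢ with ht
    · exact absurd rfl ht0
    · refine ⟨?_, rfl⟩
      by_contra hne
      have hs2 : j - (s : ℕ) ≠ i + 1 := fun h0 => hne (by rw [h0])
      have := hall (j - s) (by omega) (by omega) hadj.symm
      omega
  · rintro _ _ ⟨s, rfl⟩ ⟨t, rfl⟩ hs0 ht0 hadj
    have hs := s.is_lt
    have hs1 : (s : ℕ) ≠ 0 := fun h0 => hs0 (by simp [h0])
    beta_reduce at ht0 hadj ⊢
    split_ifs at ht0 hadj ⊢ with ht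
    · exact absurd rfl ht0
    · refine ⟨?_, rfl⟩
      by_contra hne
      have hs2 : j + (s : ℕ) ≠ i + n := fun h0 => hne (by rw [h0, hci])
      have := hall (j + s) (by omega) (by omega) hadj.symm
      omega

lemma not_quad (h : IsUnrolled G n c) (hJ : ¬ ContainsJewel G) {x : V}
    (hx : Major G n c x) (i : ℤ) (h1 : G.Adj x (c i)) (h2 : G.Adj x (c (i + 3))) :
    ¬ ∀ k, i + 3 < k → k < i + n → ¬ G.Adj x (c k) := by
  intro hall
  have h5 := h.five_le
  have hci : c (i + n) = c i := h.periodic i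
  have hadj : ∀ a b, a < b → b < a + n → (G.Adj (c a) (c b) ↔ b = a + 1 ∨ b = a + n - 1) := h.adj
  obtain ⟨k, hk⟩ : ∃ k : ℕ, (k : ℤ) = n - 3 := ⟨(n - 3).toNat, by omega⟩
  refine hJ ⟨c i, c (i + 1), c (i + 2), c (i + 3), x, k, _, ?_, ?_, ?_, ?_, h2.symm, h1,
    ?_, ?_, ?_, (h.seq_down (i + n) (k := k) (by omega)).isInducedPathMap, by simpa using hci,
    ?_, ?_⟩
  · simp [h.ne i (i + 1) (by omega) (by omega), h.ne i (i + 2) (by omega) (by omega),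
      h.ne i (i + 3) (by omega) (by omega), h.ne (i + 1) (i + 2) (by omega) (by omega),
      h.ne (i + 1) (i + 3) (by omega) (by omega), h.ne (i + 2) (i + 3) (by omega) (by omega),
      (hx.1 _).symm]
  · rw [hadj _ _ (by omega) (by omega)]; omega
  · rw [hadj _ _ (by omega) (by omega)]; omega
  · rw [hadj _ _ (by omega) (by omega)]; omega
  · rw [hadj _ _ (by omega) (by omega)]; omega
  · rw [hadj _ _ (by omega) (by omega)]; omega
  · rw [hadj _ _ (by omega) (by omega)]; omega
  · simp only [Fin.val_last]
    rw [hk]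
    congr 1
    ring
  · intro t ht0 ht1
    have ht := t.is_lt
    have ht2 : (t : ℕ) ≠ 0 := fun h0 => ht0 (Fin.ext h0)
    have ht3 : (t : ℕ) ≠ k := fun h0 => ht1 (Fin.ext h0)
    refine ⟨?_, ?_, hall _ (by omega) (by omega)⟩
    · rw [hadj _ _ (by omega) (by omega)]; omega
    · rw [hadj _ _ (by omega) (by omega)]; omega

lemma majorTrace (h : IsUnrolled G n c) (hJ : ¬ ContainsJewel G) (hP : ¬ ContainsPyramid G)
    {x : V} (hx : Major G n c x) : MajorTrace n (fun k => G.Adj x (c k)) where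
  periodic := h.trace_periodic x
  gap := h.gap hx
  major := hx.2
  not_triple := h.not_triple hP hx
  not_quad := h.not_quad hJ hx

/-- A link, traversed from its neighbour of `x` to its neighbour of `y`. -/
lemma exists_seq (h : IsUnrolled G n c) {x y : V} {a b : ℤ} {k : ℕ} (hk : (k : ℤ) = b - a)
    (hkn : (k : ℤ) + 2 ≤ n)
    (hl : Link (fun k => G.Adj x (c k)) (fun k => G.Adj y (c k)) a b ∨
      Link (fun k => G.Adj y (c k)) (fun k => G.Adj x (c k)) a b) :
    ∃ p : ℕ → V, IsInducedSeq G k p ∧ (∀ i ≤ k, ∃ t, a ≤ t ∧ t ≤ b ∧ p i = c t) ∧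
      (∀ i ≤ k, (G.Adj x (p i) ↔ i = 0)) ∧ ∀ i ≤ k, (G.Adj y (p i) ↔ i = k) := by
  rcases hl with ⟨-, hx, hy, hl⟩ | ⟨-, hy, hx, hl⟩
  · refine ⟨fun i => c (a + i), h.seq_up a hkn, fun i hi => ⟨a + i, by omega, by omega, rfl⟩,
      fun i hi => ⟨fun hadj => ?_, ?_⟩, fun i hi => ⟨fun hadj => ?_, ?_⟩⟩
    · have := (hl _ (by omega) (by omega)).1 hadj
      omega
    · rintro rfl
      simpa using hx
    · have := (hl _ (by omega) (by omega)).2 hadj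
      omega
    · rintro rfl
      beta_reduce
      rwa [hk, add_sub_cancel]
  · refine ⟨fun i => c (b - i), h.seq_down b hkn, fun i hi => ⟨b - i, by omega, by omega, rfl⟩,
      fun i hi => ⟨fun hadj => ?_, ?_⟩, fun i hi => ⟨fun hadj => ?_, ?_⟩⟩
    · have := (hl _ (by omega) (by omega)).2 hadj
      omega
    · rintro rfl
      simpa using hx
    · have := (hl _ (by omega) (by omega)).1 hadj
      omega
    · rintro rfl
      beta_reduce
      rwa [hk, sub_sub_cancel]

lemma majorPair (h : IsUnrolled G n c) (hJ : ¬ ContainsJewel G) (hP : ¬ ContainsPyramid G)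
    {x y : V} (hx : Major G n c x) (hy : Major G n c y) (hne : x ≠ y) (hxy : ¬ G.Adj x y) :
    MajorPair n (fun k => G.Adj x (c k)) (fun k => G.Adj y (c k)) where
  odd := h.odd
  left := h.majorTrace hJ hP hx
  right := h.majorTrace hJ hP hy
  cross a b d e hl hl' hodd heven h1 h2 := by
    have hab : a ≤ b := by rcases hl with hl | hl <;> exact hl.1
    have hde : d ≤ e := by rcases hl' with hl | hl <;> exact hl.1
    have hn := h.odd
    obtain ⟨k, hk⟩ : ∃ k : ℕ, (k : ℤ) = b - a := ⟨(b - a).toNat, by omega⟩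
    obtain ⟨l, hl0⟩ : ∃ l : ℕ, (l : ℤ) = e - d := ⟨(e - d).toNat, by omega⟩
    obtain ⟨p, hp, hpc, hxp, hyp⟩ := h.exists_seq hk (by omega) hl
    obtain ⟨q, hq, hqc, hyq, hxq⟩ := h.exists_seq hl0 (by omega) hl'.symm
    have off : ∀ {z : V}, Major G n c z → (∀ i ≤ k, z ≠ p i) ∧ ∀ i ≤ l, z ≠ q i :=
      fun hz => ⟨fun i hi => by
        obtain ⟨t, -, -, ht⟩ := hpc i hi
        rw [ht]
        exact hz.1 t, fun i hi => by
        obtain ⟨t, -, -, ht⟩ := hqc i hi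
        rw [ht]
        exact hz.1 t⟩
    obtain ⟨g, hg⟩ := isHole_of_two_paths hp hq (fun i hi j hj => by
        obtain ⟨s, hs1, hs2, hs⟩ := hpc i hi
        obtain ⟨t, ht1, ht2, ht⟩ := hqc j hj
        rw [hs, ht, h.adj _ _ (by omega) (by omega)]
        exact ⟨h.ne _ _ (by omega) (by omega), by omega⟩) hne hxy
      (fun i hi => ⟨(off hx).1 i hi, hxp i hi⟩) (fun i hi => ⟨(off hy).1 i hi, hyp i hi⟩)
      (fun i hi => ⟨(off hy).2 i hi, hyq i hi⟩) (fun i hi => ⟨(off hx).2 i hi, hxq i hi⟩)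
    have := h.shortest _ _ ⟨hg, Nat.odd_iff.2 (by omega)⟩
    push_cast at this
    omega

end IsUnrolled

/-- Consecutive members of `S` at odd distance are adjacent integers. -/
def GapsEven (S : ℤ → Prop) : Prop :=
  ∀ i j, i < j → S i → S j → (∀ k, i < k → k < j → ¬ S k) → (j - i) % 2 = 1 → j = i + 1

open Classical in
/-- The indicator, modulo two, of the edges `k, k + 1` with both ends in `S`. -/
noncomputable def edgeIndicator (S : ℤ → Prop) (k : ℤ) : ZMod 2 :=
  if S k ∧ S (k + 1) then 1 else 0

lemma edgeIndicator_of_not {S : ℤ → Prop} {k : ℤ} (h : ¬ (S k ∧ S (k + 1))) :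
    edgeIndicator S k = 0 := if_neg h

lemma edgeIndicator_of_mem {S : ℤ → Prop} {k : ℤ} (h : S k) (h' : S (k + 1)) :
    edgeIndicator S k = 1 := if_pos ⟨h, h'⟩

lemma prod_edgeIndicator {ι : Type*} (A : ι → ℤ → Prop) (T : Finset ι) (k : ℤ) :
    ∏ x ∈ T, edgeIndicator (A x) k = edgeIndicator (fun l => ∀ x ∈ T, A x l) k := by
  by_cases h : ∀ x ∈ T, A x k ∧ A x (k + 1)
  · rw [edgeIndicator_of_mem (fun x hx => (h x hx).1) (fun x hx => (h x hx).2)]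
    exact Finset.prod_eq_one fun x hx => edgeIndicator_of_mem (h x hx).1 (h x hx).2
  · rw [edgeIndicator_of_not (S := fun l => ∀ x ∈ T, A x l)
      fun h' => h fun x hx => ⟨h'.1 x hx, h'.2 x hx⟩]
    push Not at h
    obtain ⟨x, hx, hk⟩ := h
    exact Finset.prod_eq_zero hx (edgeIndicator_of_not fun h' => hk h'.1 h'.2)

lemma GapsEven.sum_edgeIndicator {S : ℤ → Prop} (hS : GapsEven S) {a : ℤ} (ha : S a) (m : ℕ)
    (hm : S (a + m)) : ∑ t ∈ Finset.range m, edgeIndicator S (a + t) = m := by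
  induction m using Nat.strong_induction_on with
  | _ m ih =>
    rcases Nat.eq_zero_or_pos m with rfl | hpos
    · simp
    obtain ⟨s, h1, h2, h3, h4⟩ :=
      Int.exists_last_of_le (A := S) (show a ≤ a + m - 1 by omega) ha
    obtain ⟨l, rfl⟩ : ∃ l : ℕ, s = a + l := ⟨(s - a).toNat, by omega⟩
    obtain ⟨d, rfl⟩ : ∃ d : ℕ, m = l + d := ⟨m - l, by omega⟩
    push_cast at *
    rw [Finset.sum_range_add, ih l (by omega) h3]
    congr 1
    rcases eq_or_ne d 1 with rfl | hd
    · simpa using edgeIndicator_of_mem h3 (by simpa [add_assoc] using hm)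
    · have heven : d % 2 = 0 := by
        by_contra hodd
        have := hS (a + l) (a + (l + d)) (by omega) h3 hm
          (fun k hk1 hk2 => h4 k hk1 (by omega)) (by omega)
        omega
      rw [Finset.sum_eq_zero, eq_comm, ZMod.natCast_eq_zero_iff]
      · omega
      · intro t ht
        have := Finset.mem_range.1 ht
        refine edgeIndicator_of_not fun h => ?_
        push_cast at h
        rcases Nat.eq_zero_or_pos t with rfl | ht0
        · exact h4 _ (by omega) (by omega) h.2
        · exact h4 _ (by omega) (by omega) h.1

lemma sum_range_period {M : Type*} [AddCommGroup M] {F : ℤ → M} {n : ℕ}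
    (hF : ∀ k, F (k + n) = F k) (a b : ℤ) :
    ∑ t ∈ Finset.range n, F (a + t) = ∑ t ∈ Finset.range n, F (b + t) := by
  have step : ∀ a, ∑ t ∈ Finset.range n, F (a + 1 + t) = ∑ t ∈ Finset.range n, F (a + t) := by
    intro a
    have h1 := Finset.sum_range_succ (fun t : ℕ => F (a + t)) n
    have h2 := Finset.sum_range_succ' (fun t : ℕ => F (a + t)) n
    rw [h1, hF] at h2
    simp only [Nat.cast_zero, add_zero] at h2
    rw [add_right_cancel h2]
    refine Finset.sum_congr rfl fun t _ => ?_
    congr 1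
    push_cast
    ring
  have zero : ∀ a, ∑ t ∈ Finset.range n, F (a + t) = ∑ t ∈ Finset.range n, F (0 + t) := by
    intro a
    induction a using Int.induction_on with
    | zero => rfl
    | succ i ih => rw [step, ih]
    | pred i ih => rw [← ih, ← step (-i - 1), sub_add_cancel]
  rw [zero a, zero b]

lemma GapsEven.sum_edgeIndicator_period {S : ℤ → Prop} (hS : GapsEven S) {n : ℕ}
    (hn : ∀ k, S (k + n) ↔ S k) (h : ∃ k, S k) (a : ℤ) :
    ∑ t ∈ Finset.range n, edgeIndicator S (a + t) = n := by
  obtain ⟨k, hk⟩ := h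
  rw [← hS.sum_edgeIndicator hk n ((hn k).2 hk)]
  refine sum_range_period (F := edgeIndicator S) (fun l => ?_) a k
  unfold edgeIndicator
  rw [add_right_comm, hn, hn]

section Family

variable {ι : Type*} {A : ι → ℤ → Prop} {S : Finset ι}

/-- Inclusion-exclusion modulo two: an odd number of edges cannot carry an odd number of edges
complete to each proper subfamily, an odd number meeting the family, and none complete to it. -/
lemma false_of_sum_edgeIndicator (hS : S.Nonempty) (a : ℤ) (m : ℕ) (hm : m % 2 = 1)
    (hsub : ∀ T ⊂ S,
      ∑ t ∈ Finset.range m, edgeIndicator (fun k => ∀ x ∈ T, A x k) (a + t) = m)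
    (hall : ∑ t ∈ Finset.range m, edgeIndicator (fun k => ∀ x ∈ S, A x k) (a + t) = 0)
    (hany : ∑ t ∈ Finset.range m, edgeIndicator (fun k => ∃ x ∈ S, A x k) (a + t) = m)
    (hcommon : ∀ k, (∃ x ∈ S, A x k) → (∃ x ∈ S, A x (k + 1)) → ∃ x ∈ S, A x k ∧ A x (k + 1)) :
    False := by
  classical
  have hm1 : (m : ZMod 2) = 1 := by
    rw [← ZMod.natCast_mod, hm, Nat.cast_one]
  have two : (1 + 1 : ZMod 2) = 0 := rfl
  have hterm : ∀ k, ∏ x ∈ S, (1 + edgeIndicator (A x) k) =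
      1 + edgeIndicator (fun k => ∃ x ∈ S, A x k) k := by
    intro k
    by_cases h : (∃ x ∈ S, A x k) ∧ ∃ x ∈ S, A x (k + 1)
    · rw [edgeIndicator_of_mem h.1 h.2, two]
      obtain ⟨x, hx, h1, h2⟩ := hcommon k h.1 h.2
      exact Finset.prod_eq_zero hx (by rw [edgeIndicator_of_mem h1 h2, two])
    · rw [edgeIndicator_of_not h, add_zero]
      refine Finset.prod_eq_one fun x hx => ?_
      rw [edgeIndicator_of_not fun h' => h ⟨⟨x, hx, h'.1⟩, ⟨x, hx, h'.2⟩⟩, add_zero]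
  have hleft : ∑ t ∈ Finset.range m, ∏ x ∈ S, (1 + edgeIndicator (A x) (a + t)) = 0 := by
    simp only [hterm]
    rw [Finset.sum_add_distrib, hany, Finset.sum_const, Finset.card_range, nsmul_one, hm1, two]
  have hsum : ∀ T ∈ S.powerset, ∑ t ∈ Finset.range m, ∏ x ∈ T, edgeIndicator (A x) (a + t) =
      1 + if T = S then 1 else 0 := by
    intro T hT
    simp only [prod_edgeIndicator]
    split_ifs with h
    · rw [h, hall, two]
    · rw [hsub T ((Finset.mem_powerset.1 hT).ssubset_of_ne h), hm1, add_zero]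
  simp only [Finset.prod_one_add] at hleft
  rw [Finset.sum_comm, Finset.sum_congr rfl hsum, Finset.sum_add_distrib, Finset.sum_ite_eq',
    if_pos (Finset.mem_powerset_self S), Finset.sum_const, Finset.card_powerset, nsmul_one,
    Nat.cast_pow, show ((2 : ℕ) : ZMod 2) = 0 from rfl, zero_pow hS.card_pos.ne', zero_add]
    at hleft
  exact one_ne_zero hleft

lemma exists_common_of_consecutive (hgap : ∀ x ∈ S, GapsEven (A x))
    (hlink : ∀ x ∈ S, ∀ y ∈ S, x ≠ y → ∀ a b, Link (A x) (A y) a b → (b - a) % 2 ≠ 1)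
    {i j : ℤ} (hij : i < j) (hi : ∃ x ∈ S, A x i) (hj : ∃ x ∈ S, A x j)
    (hk : ∀ k, i < k → k < j → ¬ ∃ x ∈ S, A x k) (hodd : (j - i) % 2 = 1) :
    j = i + 1 ∧ ∃ x ∈ S, A x i ∧ A x j := by
  by_cases hcom : ∃ x ∈ S, A x i ∧ A x j
  · refine ⟨?_, hcom⟩
    obtain ⟨x, hx, h1, h2⟩ := hcom
    exact hgap x hx i j hij h1 h2 (fun k h3 h4 h5 => hk k h3 h4 ⟨x, hx, h5⟩) hodd
  · exfalso
    push Not at hcom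
    obtain ⟨x, hx, hxi⟩ := hi
    obtain ⟨y, hy, hyj⟩ := hj
    refine hlink x hx y hy (fun h => hcom x hx hxi (h ▸ hyj)) i j
      ⟨hij.le, hxi, hyj, fun k h1 h2 => ⟨fun h => ?_, fun h => ?_⟩⟩ hodd
    · by_contra hne
      rcases eq_or_ne k j with rfl | hne'
      · exact hcom x hx hxi h
      · exact hk k (by omega) (by omega) ⟨x, hx, h⟩
    · by_contra hne
      rcases eq_or_ne k i with rfl | hne'
      · exact hcom y hy h hyj
      · exact hk k (by omega) (by omega) ⟨y, hy, h⟩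

theorem exists_and_gapsEven_forall {n : ℕ} (hn : n % 2 = 1)
    (hper : ∀ x ∈ S, ∀ k, A x (k + n) ↔ A x k) (hex : ∀ x ∈ S, ∃ k, A x k)
    (hgap : ∀ x ∈ S, GapsEven (A x))
    (hlink : ∀ x ∈ S, ∀ y ∈ S, x ≠ y → ∀ a b, Link (A x) (A y) a b → (b - a) % 2 ≠ 1) :
    (∃ k, ∀ x ∈ S, A x k) ∧ GapsEven (fun k => ∀ x ∈ S, A x k) := by
  induction S using Finset.strongInduction with
  | H S ih =>
    rcases S.eq_empty_or_nonempty with rfl | hS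
    · refine ⟨⟨0, by simp⟩, fun i j hij _ _ hk _ => ?_⟩
      by_contra hne
      exact hk (i + 1) (by omega) (by omega) (by simp)
    have hT : ∀ T ⊂ S, (∃ k, ∀ x ∈ T, A x k) ∧ GapsEven (fun k => ∀ x ∈ T, A x k) :=
      fun T hT => ih T hT (fun x hx => hper x (hT.1 hx)) (fun x hx => hex x (hT.1 hx))
        (fun x hx => hgap x (hT.1 hx)) fun x hx y hy => hlink x (hT.1 hx) y (hT.1 hy)
    have hWgap : GapsEven (fun k => ∃ x ∈ S, A x k) := fun i j hij hi hj hk hodd =>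
      (exists_common_of_consecutive hgap hlink hij hi hj hk hodd).1
    have hcommon : ∀ k, (∃ x ∈ S, A x k) → (∃ x ∈ S, A x (k + 1)) →
        ∃ x ∈ S, A x k ∧ A x (k + 1) := fun k h1 h2 =>
      (exists_common_of_consecutive hgap hlink (by omega) h1 h2 (fun l _ _ => by omega)
        (by omega)).2
    obtain ⟨x, hx⟩ := hS
    constructor
    · by_contra hnone
      push Not at hnone
      refine false_of_sum_edgeIndicator (A := A) ⟨x, hx⟩ 0 n hn (fun T hTS => ?_) ?_ ?_ hcommon
      · exact (hT T hTS).2.sum_edgeIndicator_period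
          (fun k => forall₂_congr fun y hy => hper y (hTS.1 hy) k) (hT T hTS).1 0
      · refine Finset.sum_eq_zero fun t _ => edgeIndicator_of_not fun h => ?_
        obtain ⟨y, hy, hy'⟩ := hnone (0 + t)
        exact hy' (h.1 y hy)
      · obtain ⟨k, hk⟩ := hex x hx
        refine hWgap.sum_edgeIndicator_period (fun k => ?_) ⟨k, x, hx, hk⟩ 0
        exact exists_congr fun y => and_congr_right fun hy => hper y hy k
    · intro i j hij hi hj hk hodd
      by_contra hne
      obtain ⟨m, hm⟩ : ∃ m : ℕ, (m : ℤ) = j - i := ⟨(j - i).toNat, by omega⟩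
      obtain rfl : j = i + m := by omega
      refine false_of_sum_edgeIndicator (A := A) ⟨x, hx⟩ i m (by omega) (fun T hTS => ?_) ?_ ?_
        hcommon
      · exact (hT T hTS).2.sum_edgeIndicator (fun y hy => hi y (hTS.1 hy)) m
          fun y hy => hj y (hTS.1 hy)
      · refine Finset.sum_eq_zero fun t ht => edgeIndicator_of_not fun h => ?_
        have := Finset.mem_range.1 ht
        rcases Nat.eq_zero_or_pos t with rfl | ht0
        · exact hk _ (by omega) (by omega) h.2
        · exact hk _ (by omega) (by omega) h.1
      · exact hWgap.sum_edgeIndicator ⟨x, hx, hi x hx⟩ m ⟨x, hx, hj x hx⟩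

end Family

lemma IsCMajor.major {G : SimpleGraph V} {n : ℕ} (hn : 0 < n) {f : ZMod n → V} {x : V}
    (hx : IsCMajor G f x) : IsUnrolled.Major G n (fun k : ℤ => f k) x := by
  refine ⟨fun k hk => hx.1 ⟨k, hk.symm⟩, fun i => ?_⟩
  obtain ⟨j, hadj, h1, h2, h3⟩ := hx.2 i
  obtain ⟨l, rfl⟩ := ZMod.intCast_surjective j
  have h0 := Int.emod_nonneg (l - i) (show (n : ℤ) ≠ 0 by omega)
  have hlt := Int.emod_lt_of_pos (l - i) (show 0 < (n : ℤ) by omega)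
  have hcast : ((i + (l - i) % n : ℤ) : ZMod n) = l := by
    have : (((l - i) % n : ℤ) : ZMod n) = ((l - i : ℤ) : ZMod n) := ZMod.intCast_mod _ _
    push_cast at this ⊢
    rw [this]
    ring
  generalize (l - i) % (n : ℤ) = r at *
  rw [← hcast] at h1 h2 h3 hadj
  have hr0 : r ≠ 0 := fun h => h2 (by simp [h])
  have hr1 : r ≠ 1 := fun h => h3 (by simp [h])
  have hr2 : r ≠ n - 1 := fun h => h1 (by simp [h, sub_eq_add_neg])
  exact ⟨i + r, by omega, by omega, hadj⟩

/-- In a graph with no jewel or pyramid, if `C` is a shortest odd hole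
and `X` is a stable set of `C`-major vertices, then the set of `X`-complete vertices
of `C` is normal in `C`. -/
theorem stable_major_complete_normal {V : Type*} [Fintype V] (G : SimpleGraph V)
    (hJ : ¬ ContainsJewel G) (hP : ¬ ContainsPyramid G)
    (n : ℕ) (f : ZMod n → V) (hC : IsShortestOddHole G n f)
    (X : Set V) (hXmaj : ∀ x ∈ X, IsCMajor G f x)
    (hXstable : ∀ x ∈ X, ∀ y ∈ X, ¬ G.Adj x y) :
    NormalInCycle n {i : ZMod n | ∀ x ∈ X, G.Adj (f i) x} := by
  classical
  have h := hC.isUnrolled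
  have hn : n % 2 = 1 := Nat.odd_iff.1 hC.1.2
  have hmaj : ∀ x ∈ X, IsUnrolled.Major G n (fun k : ℤ => f k) x :=
    fun x hx => (hXmaj x hx).major (by omega)
  obtain ⟨⟨k, hk⟩, hgaps⟩ := exists_and_gapsEven_forall (S := X.toFinite.toFinset)
    (A := fun x k => G.Adj x (f (k : ℤ))) hn (fun x _ k => h.trace_periodic x k)
    (fun x hx => by
      obtain ⟨k, -, -, hk⟩ := (hmaj x (by simpa using hx)).2 0
      exact ⟨k, hk⟩)
    (fun x hx => h.gap (hmaj x (by simpa using hx)))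
    (fun x hx y hy hne a b hl hodd => by
      rw [Set.Finite.mem_toFinset] at hx hy
      exact (h.majorPair hJ hP (hmaj x hx) (hmaj y hy) hne (hXstable x hx y hy)).not_odd_link
        hl hodd)
  simp only [Set.Finite.mem_toFinset] at hk hgaps
  simp only [G.adj_comm (f _)]
  rintro ℓ (⟨hempty, -⟩ | ⟨h2, -, i, hi, hil, hnone⟩)
  · exact absurd (show (k : ZMod n) ∈ {i : ZMod n | ∀ x ∈ X, G.Adj x (f i)} from hk) (by simp [hempty])
  · obtain ⟨l, rfl⟩ := ZMod.intCast_surjective i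
    rw [← Nat.not_odd_iff_even, Nat.odd_iff]
    intro hodd
    have := hgaps l (l + ℓ) (by omega) hi (by simpa using hil) (fun k hk1 hk2 hk => by
      obtain ⟨t, rfl⟩ : ∃ t : ℕ, k = l + t := ⟨(k - l).toNat, by omega⟩
      exact hnone t (by omega) (by omega) (by simpa using hk)) (by omega)
    omega
end
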